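/- arXiv:1909.06538 — 5 statements merged into one kernel-verified Lean document; each statement's English description precedes it below -/
import Mathlib

section
/- Let S be a dense triangulated subcategory of a triangulated category T. Then for every object x of T, the object x ⊕ Σx belongs to S, where Σ is the suspension functor. -/
/-!
Statement 1: If `S` is a dense triangulated subcategory of a triangulated category `T`,
then for every object `x` of `T`, the object `x ⊕ Σx` belongs to `S`.
-/

open CategoryTheory Limits Pretriangulated ZeroObject

universe v u

namespace Stmt1

variable {C : Type u} [Category.{v} C] [HasZeroObject C] [Preadditive C]
  [HasShift C ℤ] [∀ n : ℤ, (shiftFunctor C n).Additive] [Pretriangulated C]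

/-- `x` is a direct summand of `y`: the identity of `x` factors through `y`. -/
def IsDirectSummand (x y : C) : Prop :=
  ∃ (i : x ⟶ y) (r : y ⟶ x), i ≫ r = 𝟙 x

/-- A class of objects `S` is a (full) triangulated subcategory. -/
structure IsTriangulatedSub (S : Set C) : Prop where
  zero_mem : (0 : C) ∈ S
  iso_mem : ∀ (x y : C), (x ≅ y) → x ∈ S → y ∈ S
  shift_mem : ∀ (x : C) (n : ℤ), x ∈ S → (x⟦n⟧ : C) ∈ S
  ext_mem : ∀ (T : Triangle C), (T ∈ distTriang C) → T.obj₁ ∈ S → T.obj₃ ∈ S → T.obj₂ ∈ S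

/-- A triangulated subcategory `S` of `T` is dense if its thick closure is all of `T`,
i.e. every object of `T` is a direct summand of an object of `S`. -/
def IsDense (S : Set C) : Prop :=
  ∀ x : C, ∃ y ∈ S, IsDirectSummand x y

variable [HasBinaryBiproducts C]

/-- A product indexed by `WalkingPair` is a binary biproduct. -/
noncomputable def piWalkingPairIsoBiprod (f : WalkingPair → C) [HasProduct f] :
    ∏ᶜ f ≅ f .left ⊞ f .right :=
  HasLimit.isoOfNatIso (diagramIsoPair (Discrete.functor f)) ≪≫ (biprod.isoProd _ _).symm

/-- Direct summands in a pretriangulated category admit complements. -/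
theorem IsDirectSummand.exists_iso_biprod {x s : C} (h : IsDirectSummand x s) :
    ∃ y : C, Nonempty (s ≅ x ⊞ y) := by
  obtain ⟨i, r, hir⟩ := h
  obtain ⟨y, g, d, hT⟩ := distinguished_cocone_triangle i
  have : Mono i := (SplitMono.mk r hir).mono
  obtain ⟨e, -, -⟩ := exists_iso_binaryBiproduct_of_distTriang _ hT
    (Triangle.mor₃_eq_zero_of_mono₁ _ hT this)
  exact ⟨y, ⟨e⟩⟩

/-- If `S` is a dense triangulated subcategory of `T`, then for every
object `x` of `T`, the object `x ⊕ Σx` belongs to `S`. -/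
theorem biprod_shift_mem_of_dense (S : Set C) (hS : IsTriangulatedSub S)
    (hdense : IsDense S) (x : C) : (x ⊞ (x⟦(1 : ℤ)⟧) : C) ∈ S := by
  obtain ⟨s, hs, hxs⟩ := hdense x
  obtain ⟨y, ⟨e⟩⟩ := hxs.exists_iso_biprod
  let T : WalkingPair → Triangle C := fun j => WalkingPair.casesOn j
    (binaryBiproductTriangle x (x⟦(1 : ℤ)⟧)) (contractibleTriangle y).rotate
  have hT : ∀ j, T j ∈ distTriang C := by
    rintro (_ | _)
    · exact binaryBiproductTriangle_distinguished _ _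
    · exact rot_of_distTriang _ (contractible_distinguished y)
  have := preservesBinaryBiproducts_of_preservesBiproducts (shiftFunctor C (1 : ℤ))
  have h₁ : (productTriangle T).obj₁ ∈ S :=
    hS.iso_mem _ _ (e ≪≫ (piWalkingPairIsoBiprod fun j => (T j).obj₁).symm) hs
  have h₃ : (productTriangle T).obj₃ ∈ S :=
    hS.iso_mem _ _ ((shiftFunctor C (1 : ℤ)).mapIso e ≪≫
      (shiftFunctor C (1 : ℤ)).mapBiprod x y ≪≫
      (piWalkingPairIsoBiprod fun j => (T j).obj₃).symm) (hS.shift_mem s 1 hs)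
  exact hS.iso_mem _ _ ((piWalkingPairIsoBiprod fun j => (T j).obj₂) ≪≫
    (isoBiprodZero (isZero_zero C)).symm)
    (hS.ext_mem _ (productTriangle_distinguished T hT) h₁ h₃)

end Stmt1
end

section
/- Let F : T → T' be a triangulated functor which has a fully faithful right adjoint G (equivalently, a right adjoint G whose counit F∘G → id is an isomorphism). Then Ker F is a thick triangulated subcategory of T, and F induces an equivalence of triangulated categories T / Ker F ≃ T'. -/
/-!
Statement 3: If a triangulated functor `F : T ⥤ T'` has a fully faithful right adjoint,
then `Ker F` is a thick triangulated subcategory and `F` induces an equivalence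
`T / Ker F ≃ T'`.
-/

open CategoryTheory Limits Pretriangulated ZeroObject

universe v u v' u'

namespace Stmt3

variable {C : Type u} [Category.{v} C] [HasZeroObject C] [Preadditive C]
  [HasShift C ℤ] [∀ n : ℤ, (shiftFunctor C n).Additive] [Pretriangulated C]

/-- `x` is a direct summand of `y`. -/
def IsDirectSummand (x y : C) : Prop :=
  ∃ (i : x ⟶ y) (r : y ⟶ x), i ≫ r = 𝟙 x

/-- A class of objects `S` is a (full) triangulated subcategory. -/
structure IsTriangulatedSub (S : Set C) : Prop where
  zero_mem : (0 : C) ∈ S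
  iso_mem : ∀ (x y : C), (x ≅ y) → x ∈ S → y ∈ S
  shift_mem : ∀ (x : C) (n : ℤ), x ∈ S → (x⟦n⟧ : C) ∈ S
  ext_mem : ∀ (T : Triangle C), (T ∈ distTriang C) → T.obj₁ ∈ S → T.obj₃ ∈ S → T.obj₂ ∈ S

/-- Thick: closed under direct summands. -/
def IsThick (S : Set C) : Prop :=
  ∀ (x y : C), y ∈ S → IsDirectSummand x y → x ∈ S

/-- The class of morphisms whose cone belongs to `S`; inverting these morphisms
produces the Verdier quotient `T/S`. -/
def modW (S : Set C) : MorphismProperty C :=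
  fun X Y f => ∃ (Z : C) (g : Y ⟶ Z) (h : Z ⟶ (X⟦(1 : ℤ)⟧ : C)),
    (Triangle.mk f g h ∈ distTriang C) ∧ Z ∈ S

variable {D : Type u'} [Category.{v'} D] [HasZeroObject D] [Preadditive D]
  [HasShift D ℤ] [∀ n : ℤ, (shiftFunctor D n).Additive] [Pretriangulated D]

/-- The kernel of a functor: objects sent to a zero object. -/
def kerSet (F : C ⥤ D) : Set C := {x : C | IsZero (F.obj x)}

/-- A morphism has a cone in the kernel of a triangulated functor `F` if and only if
`F` sends it to an isomorphism. -/
theorem modW_kerSet_eq_inverseImage_isomorphisms (F : C ⥤ D) [F.CommShift ℤ]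
    [F.IsTriangulated] :
    modW (kerSet F) = (MorphismProperty.isomorphisms D).inverseImage F := by
  ext X Y f
  constructor
  · rintro ⟨Z, g, h, hT, hZ⟩
    exact (Triangle.isZero₃_iff_isIso₁ _ (F.map_distinguished _ hT)).1 hZ
  · intro hf
    obtain ⟨Z, g, h, hT⟩ := distinguished_cocone_triangle f
    exact ⟨Z, g, h, hT,
      (Triangle.isZero₃_iff_isIso₁ _ (F.map_distinguished _ hT)).2 hf⟩

/-- The kernel of a triangulated functor is a triangulated subcategory. -/
theorem isTriangulatedSub_kerSet (F : C ⥤ D) [F.CommShift ℤ] [F.IsTriangulated] :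
    IsTriangulatedSub (kerSet F) where
  zero_mem := F.map_isZero (isZero_zero C)
  iso_mem _ _ e hx := IsZero.of_iso hx (F.mapIso e.symm)
  shift_mem x n hx :=
    IsZero.of_iso ((shiftFunctor D n).map_isZero hx) ((F.commShiftIso n).app x)
  ext_mem T hT h₁ h₃ :=
    (Triangle.isZero₂_iff _ (F.map_distinguished T hT)).2
      ⟨IsZero.eq_of_src h₁ _ _, IsZero.eq_of_tgt h₃ _ _⟩

/-- The kernel of a functor is closed under direct summands. -/
theorem isThick_kerSet {A : Type*} [Category A] {B : Type*} [Category B] [HasZeroMorphisms B]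
    (F : A ⥤ B) : IsThick (kerSet F) := by
  rintro x y hy ⟨i, r, hir⟩
  change IsZero (F.obj x)
  rw [IsZero.iff_id_eq_zero, ← F.map_id, ← hir, F.map_comp, IsZero.eq_of_src hy (F.map r) 0,
    comp_zero]

/-- Let `F : T ⥤ T'` be a triangulated functor admitting a right adjoint
`G` which is fully faithful (equivalently, whose counit `F ⋙ G ⟶ id` is an isomorphism).
Then `Ker F` is a thick triangulated subcategory of `T`, and `F` induces an equivalence of
triangulated categories `T / Ker F ≃ T'`. -/
theorem quotient_kernel_equivalence (F : C ⥤ D) [F.CommShift ℤ] [F.IsTriangulated]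
    (G : D ⥤ C) (adj : F ⊣ G) (hfull : G.Full) (hfaithful : G.Faithful) :
    (IsTriangulatedSub (kerSet F) ∧ IsThick (kerSet F)) ∧
      ∃ (E : (modW (kerSet F)).Localization ⥤ D),
        Nonempty ((modW (kerSet F)).Q ⋙ E ≅ F) ∧ E.IsEquivalence := by
  refine ⟨⟨isTriangulatedSub_kerSet F, isThick_kerSet F⟩, ?_⟩
  have hF : F.IsLocalization (modW (kerSet F)) := by
    rw [modW_kerSet_eq_inverseImage_isomorphisms]
    exact adj.isLocalization
  exact ⟨(Localization.equivalenceFromModel F (modW (kerSet F))).functor,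
    ⟨Localization.qCompEquivalenceFromModelFunctorIso F (modW (kerSet F))⟩, inferInstance⟩

end Stmt3
end

section
/- Let A and B be full subcategories of a triangulated category T with small coproducts. Then: (1) smd(A) * B ⊆ smd(A * B) and A * smd(B) ⊆ smd(A * B); (2) smd(smd(A) * B) = smd(A * smd(B)) = smd(A * B). -/
/-!
Statement 15: For full subcategories `A`, `B` of a triangulated category with small
coproducts: (1) `smd(A) * B ⊆ smd(A * B)` and `A * smd(B) ⊆ smd(A * B)`;
(2) `smd(smd(A) * B) = smd(A * smd(B)) = smd(A * B)`.
-/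

open CategoryTheory Limits Pretriangulated ZeroObject

universe v u

namespace Stmt15

variable {C : Type u} [Category.{v} C] [HasZeroObject C] [Preadditive C]
  [HasShift C ℤ] [∀ n : ℤ, (shiftFunctor C n).Additive] [Pretriangulated C]

/-- `x` is a direct summand of `y`. -/
def IsDirectSummand (x y : C) : Prop :=
  ∃ (i : x ⟶ y) (r : y ⟶ x), i ≫ r = 𝟙 x

/-- `smd(A)`: all direct summands in `C` of objects of `A`. -/
def smdSet (A : Set C) : Set C :=
  {x : C | ∃ a ∈ A, IsDirectSummand x a}

/-- `A * B` consists of the objects `y` sitting in a distinguished triangle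
`x → y → z → Σx` with `x ∈ A` and `z ∈ B`. -/
def setStar (A B : Set C) : Set C :=
  {y : C | ∃ (x z : C) (f : x ⟶ y) (g : y ⟶ z) (h : z ⟶ (x⟦(1 : ℤ)⟧ : C)),
    (Triangle.mk f g h ∈ distTriang C) ∧ x ∈ A ∧ z ∈ B}

lemma subset_smdSet {D : Type*} [Category D] (A : Set D) : A ⊆ smdSet A :=
  fun x hx => ⟨x, hx, 𝟙 x, 𝟙 x, Category.comp_id _⟩

lemma IsDirectSummand.trans {D : Type*} [Category D] {x y z : D} (hxy : IsDirectSummand x y)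
    (hyz : IsDirectSummand y z) : IsDirectSummand x z := by
  obtain ⟨i, r, hir⟩ := hxy
  obtain ⟨j, s, hjs⟩ := hyz
  exact ⟨i ≫ j, s ≫ r, by simp [reassoc_of% hjs, hir]⟩

lemma smdSet_subset_smdSet_of_subset {D : Type*} [Category D] {A B : Set D}
    (h : A ⊆ smdSet B) : smdSet A ⊆ smdSet B := by
  rintro x ⟨a, ha, hxa⟩
  obtain ⟨b, hb, hab⟩ := h ha
  exact ⟨b, hb, hxa.trans hab⟩

lemma setStar_mono {A A' B B' : Set C} (hA : A ⊆ A') (hB : B ⊆ B') :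
    setStar A B ⊆ setStar A' B' := by
  rintro y ⟨x, z, f, g, h, hT, hx, hz⟩
  exact ⟨x, z, f, g, h, hT, hA hx, hB hz⟩

/-- An extension of a direct summand of `b` by a direct summand of `a` is a direct summand
of an extension of `b` by `a`. -/
lemma setStar_smdSet_subset (A B : Set C) :
    setStar (smdSet A) (smdSet B) ⊆ smdSet (setStar A B) := by
  rintro y ⟨x, z, f, g, h, hT, ⟨a, ha, i, r, hir⟩, ⟨b, hb, j, s, hjs⟩⟩
  obtain ⟨y', f', g', hT'⟩ := distinguished_cocone_triangle₂ (s ≫ h ≫ i⟦(1 : ℤ)⟧')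
  have comm : h ≫ i⟦(1 : ℤ)⟧' = j ≫ s ≫ h ≫ i⟦(1 : ℤ)⟧' := by
    rw [reassoc_of% hjs]
  have comm' : (s ≫ h ≫ i⟦(1 : ℤ)⟧') ≫ r⟦(1 : ℤ)⟧' = s ≫ h := by
    simp [← Functor.map_comp, hir]
  obtain ⟨p, hp₁, hp₂⟩ : ∃ p : y ⟶ y', f ≫ p = i ≫ f' ∧ g ≫ j = p ≫ g' :=
    complete_distinguished_triangle_morphism₂ _ _ hT hT' i j comm
  obtain ⟨q, hq₁, hq₂⟩ : ∃ q : y' ⟶ y, f' ≫ q = r ≫ f ∧ g' ≫ s = q ≫ g :=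
    complete_distinguished_triangle_morphism₂ _ _ hT' hT r s comm'
  have comm₁ : f ≫ p ≫ q = 𝟙 x ≫ f := by
    rw [reassoc_of% hp₁, hq₁, reassoc_of% hir, Category.id_comp]
  have comm₂ : g ≫ 𝟙 z = (p ≫ q) ≫ g := by
    rw [Category.assoc, ← hq₂, ← reassoc_of% hp₂, hjs]
  have comm₃ : h ≫ (𝟙 x)⟦(1 : ℤ)⟧' = 𝟙 z ≫ h := by
    simp
  let φ : Triangle.mk f g h ⟶ Triangle.mk f g h :=
    { hom₁ := 𝟙 x
      hom₂ := p ≫ q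
      hom₃ := 𝟙 z
      comm₁ := comm₁
      comm₂ := comm₂
      comm₃ := comm₃ }
  have : IsIso (p ≫ q) := isIso₂_of_isIso₁₃ φ hT hT
    (inferInstanceAs (IsIso (𝟙 x))) (inferInstanceAs (IsIso (𝟙 z)))
  exact ⟨y', ⟨a, b, f', g', _, hT', ha, hb⟩, p, q ≫ inv (p ≫ q), by
    rw [← Category.assoc, IsIso.hom_inv_id]⟩

variable [HasCoproducts.{v} C]

/-- **Statement 15** (Bondal–Van den Bergh). For full subcategories `A` and `B` of a
triangulated category with small coproducts:
(1) `smd(A) * B ⊆ smd(A * B)` and `A * smd(B) ⊆ smd(A * B)`;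
(2) `smd(smd(A) * B) = smd(A * smd(B)) = smd(A * B)`. -/
theorem smd_star (A B : Set C) :
    (setStar (smdSet A) B ⊆ smdSet (setStar A B) ∧
      setStar A (smdSet B) ⊆ smdSet (setStar A B)) ∧
    (smdSet (setStar (smdSet A) B) = smdSet (setStar A (smdSet B)) ∧
      smdSet (setStar A (smdSet B)) = smdSet (setStar A B)) := by
  have left : setStar (smdSet A) B ⊆ smdSet (setStar A B) :=
    (setStar_mono subset_rfl (subset_smdSet B)).trans (setStar_smdSet_subset A B)
  have right : setStar A (smdSet B) ⊆ smdSet (setStar A B) :=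
    (setStar_mono (subset_smdSet A) subset_rfl).trans (setStar_smdSet_subset A B)
  have left_eq : smdSet (setStar (smdSet A) B) = smdSet (setStar A B) :=
    (smdSet_subset_smdSet_of_subset left).antisymm (smdSet_subset_smdSet_of_subset
      ((setStar_mono (subset_smdSet A) subset_rfl).trans (subset_smdSet _)))
  have right_eq : smdSet (setStar A (smdSet B)) = smdSet (setStar A B) :=
    (smdSet_subset_smdSet_of_subset right).antisymm (smdSet_subset_smdSet_of_subset
      ((setStar_mono subset_rfl (subset_smdSet B)).trans (subset_smdSet _)))
  exact ⟨⟨left, right⟩, left_eq.trans right_eq.symm, right_eq⟩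

end Stmt15
end

section
/- Let T be a triangulated category with small coproducts, B a full subcategory of T, and l a positive integer. Then Coprod_l(B) ⊆ smd(Coprod_l(B)) ⊆ Coprod_{2l}(B[−1,0]). -/
/-!
Statement 16: In a triangulated category with small coproducts, for any full
subcategory `B` and `l ≥ 1`:
`Coprod_l(B) ⊆ smd(Coprod_l(B)) ⊆ Coprod_{2l}(B[−1,0])`.
-/

open CategoryTheory Limits Pretriangulated ZeroObject

universe v u

namespace Stmt16

variable {C : Type u} [Category.{v} C] [HasZeroObject C] [Preadditive C]
  [HasShift C ℤ] [∀ n : ℤ, (shiftFunctor C n).Additive] [Pretriangulated C]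

/-- `x` is a direct summand of `y`. -/
def IsDirectSummand (x y : C) : Prop :=
  ∃ (i : x ⟶ y) (r : y ⟶ x), i ≫ r = 𝟙 x

/-- `smd(A)`: all direct summands in `C` of objects of `A`. -/
def smdSet (A : Set C) : Set C :=
  {x : C | ∃ a ∈ A, IsDirectSummand x a}

/-- `A * B`: objects `y` sitting in a distinguished triangle `x → y → z → Σx`
with `x ∈ A` and `z ∈ B`. -/
def setStar (A B : Set C) : Set C :=
  {y : C | ∃ (x z : C) (f : x ⟶ y) (g : y ⟶ z) (h : z ⟶ (x⟦(1 : ℤ)⟧ : C)),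
    (Triangle.mk f g h ∈ distTriang C) ∧ x ∈ A ∧ z ∈ B}

/-- The shift window `A[m,n] = ⋃_{m ≤ i ≤ n} A⟦−i⟧`. -/
def windowZ (A : Set C) (m n : ℤ) : Set C :=
  {x : C | ∃ (a : C) (i : ℤ), a ∈ A ∧ m ≤ i ∧ i ≤ n ∧ Nonempty (x ≅ ((a⟦(-i : ℤ)⟧ : C)))}

variable [HasCoproducts.{v} C]

/-- `Add(A)`: all small coproducts of objects of `A`. -/
def AddClos (A : Set C) : Set C :=
  {x : C | ∃ (J : Type v) (f : J → C), (∀ j, f j ∈ A) ∧ Nonempty (x ≅ ∐ f)}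

/-- `Coprod_l(A)`: `Coprod_1(A) = Add(A)` and
`Coprod_{l+1}(A) = Add(A) * Coprod_l(A)` (with `Coprod_0(A)` the zero objects). -/
def CoprodN (A : Set C) : ℕ → Set C
  | 0 => {x : C | IsZero x}
  | n + 1 => setStar (AddClos A) (CoprodN A n)

section Triangles

variable {D : Type u} [Category.{v} D] [HasZeroObject D] [Preadditive D]
  [HasShift D ℤ] [∀ n : ℤ, (shiftFunctor D n).Additive] [Pretriangulated D]

theorem exists_lift_shift_mor₁ {x y z : D} {f : x ⟶ y} {g : y ⟶ z} {h : z ⟶ x⟦(1 : ℤ)⟧}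
    (H : Triangle.mk f g h ∈ distTriang D) {t : D} (u : t ⟶ y⟦(1 : ℤ)⟧) (hu : u ≫ g⟦1⟧' = 0) :
    ∃ s : t ⟶ x⟦(1 : ℤ)⟧, u = s ≫ f⟦1⟧' := by
  obtain ⟨s, hs⟩ : ∃ s : t ⟶ x⟦(1 : ℤ)⟧, u = s ≫ (-f⟦1⟧') :=
    Triangle.coyoneda_exact₃ _ (rot_of_distTriang _ (rot_of_distTriang _ H)) u
      (show u ≫ (-g⟦1⟧') = 0 by rw [Preadditive.comp_neg, hu, neg_zero])
  exact ⟨-s, by rw [hs, Preadditive.comp_neg, Preadditive.neg_comp]⟩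

/-- The objects `x, y, z` fit, in this order, into a distinguished triangle. -/
def IsDistTriple (x y z : D) : Prop :=
  ∃ (f : x ⟶ y) (g : y ⟶ z) (h : z ⟶ x⟦(1 : ℤ)⟧), Triangle.mk f g h ∈ distTriang D

theorem IsDistTriple.of_iso {x y z x' y' z' : D} (H : IsDistTriple x y z)
    (e₁ : x ≅ x') (e₂ : y ≅ y') (e₃ : z ≅ z') : IsDistTriple x' y' z' := by
  obtain ⟨f, g, h, H⟩ := H
  refine ⟨e₁.inv ≫ f ≫ e₂.hom, e₂.inv ≫ g ≫ e₃.hom, e₃.inv ≫ h ≫ e₁.hom⟦1⟧',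
    isomorphic_distinguished _ H _ (Triangle.isoMk _ _ e₁.symm e₂.symm e₃.symm ?_ ?_ ?_)⟩
  · simp [Triangle.mk]
  · simp [Triangle.mk]
  · simp [Triangle.mk, ← Functor.map_comp]

theorem IsDistTriple.rotate {x y z : D} (H : IsDistTriple x y z) :
    IsDistTriple y z (x⟦(1 : ℤ)⟧) := by
  obtain ⟨f, g, h, H⟩ := H
  exact ⟨_, _, _, rot_of_distTriang _ H⟩

theorem IsDistTriple.shift {x y z : D} (H : IsDistTriple x y z) :
    IsDistTriple (x⟦(1 : ℤ)⟧) (y⟦(1 : ℤ)⟧) (z⟦(1 : ℤ)⟧) :=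
  H.rotate.rotate.rotate

theorem isDistTriple_biprod (x z : D) : IsDistTriple x (x ⊞ z) z :=
  ⟨_, _, _, binaryBiproductTriangle_distinguished x z⟩

theorem isDistTriple_zero_left (x : D) : IsDistTriple 0 x x :=
  ⟨_, _, _, contractible_distinguished₁ x⟩

theorem isDistTriple_zero_right (x : D) : IsDistTriple x x 0 :=
  ⟨_, _, _, contractible_distinguished x⟩

theorem isDistTriple_zero_middle (x : D) : IsDistTriple x 0 (x⟦(1 : ℤ)⟧) :=
  ⟨_, _, _, contractible_distinguished₂ x⟩

theorem IsDistTriple.nonempty_iso {x y z : D} (H : IsDistTriple x y z) (hx : IsZero x) :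
    Nonempty (y ≅ z) := by
  obtain ⟨f, g, h, H⟩ := H
  have : IsIso g := (Triangle.distinguished_iff_of_isZero₁ _ hx).1 H
  exact ⟨asIso g⟩

/-- A substitute for the octahedral axiom, valid in any pretriangulated category. Given
`c ⟶ z ⟶ z'` and `z ⟶ w ⟶ W`, let `w₁` be a cone of `c ⟶ w` and let `w₂` be the extension of
`W` by `z'` pushed out from `w`. Then `w₁` and `w₂` are isomorphic up to direct summands of
a finite sum of copies of `c⟦1⟧`. -/
theorem exists_iso_biprod_of_isDistTriple {c z z' w W : D}
    (Hz : IsDistTriple c z z') (Hw : IsDistTriple z w W) :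
    ∃ (w₁ w₂ V : D), IsDistTriple c w w₁ ∧ IsDistTriple z' w₂ W ∧
      Nonempty (w₂ ⊞ c⟦(1 : ℤ)⟧ ≅ w₁ ⊞ V) ∧
      IsDirectSummand V ((c⟦(1 : ℤ)⟧ ⊞ c⟦(1 : ℤ)⟧) ⊞ c⟦(1 : ℤ)⟧) := by
  obtain ⟨ι, g, h, Hz⟩ := Hz
  obtain ⟨j, π, φ, Hw⟩ := Hw
  obtain ⟨w₁, k, m, H₁⟩ := distinguished_cocone_triangle (ι ≫ j)
  obtain ⟨w₂, q, p, H₂⟩ := distinguished_cocone_triangle₂ (φ ≫ g⟦1⟧')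
  obtain ⟨a, hja, hap⟩ : ∃ a : w ⟶ w₂, j ≫ a = g ≫ q ∧ π ≫ 𝟙 W = a ≫ p :=
    complete_distinguished_triangle_morphism₂ _ _ Hw H₂ g (𝟙 W) (Category.id_comp _).symm
  rw [Category.comp_id] at hap
  have hιg : ι ≫ g = 0 := comp_distTriang_mor_zero₁₂ _ Hz
  have hgh : g ≫ h = 0 := comp_distTriang_mor_zero₂₃ _ Hz
  have hφj : φ ≫ j⟦1⟧' = 0 := comp_distTriang_mor_zero₃₁ _ Hw
  have hqp : q ≫ p = 0 := comp_distTriang_mor_zero₁₂ _ H₂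
  have hpφg : p ≫ φ ≫ g⟦1⟧' = 0 := comp_distTriang_mor_zero₂₃ _ H₂
  have hιjk : (ι ≫ j) ≫ k = 0 := comp_distTriang_mor_zero₁₂ _ H₁
  have hkm : k ≫ m = 0 := comp_distTriang_mor_zero₂₃ _ H₁
  obtain ⟨a', ha'⟩ : ∃ a' : w₁ ⟶ w₂, a = k ≫ a' :=
    Triangle.yoneda_exact₂ _ H₁ a (show (ι ≫ j) ≫ a = 0 by
      rw [Category.assoc, hja, reassoc_of% hιg, zero_comp])
  have hq {t : D} (s : t ⟶ z') (hs : s ≫ q = 0) :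
      ∃ η : t⟦(1 : ℤ)⟧ ⟶ W, s⟦1⟧' = η ≫ φ ≫ g⟦1⟧' :=
    Triangle.coyoneda_exact₁ _ H₂ (s⟦1⟧') (show s⟦1⟧' ≫ q⟦1⟧' = 0 by
      rw [← Functor.map_comp, hs, Functor.map_zero])
  have hmono : Mono (biprod.lift a' m) := by
    refine (Preadditive.mono_iff_cancel_zero _).2 fun t x hx => ?_
    have hxa : x ≫ a' = 0 := by simpa using hx =≫ biprod.fst
    have hxm : x ≫ m = 0 := by simpa using hx =≫ biprod.snd
    obtain ⟨y, hy⟩ : ∃ y : t ⟶ w, x = y ≫ k := Triangle.coyoneda_exact₃ _ H₁ x hxm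
    have hya : y ≫ a = 0 := by rw [ha', ← Category.assoc, ← hy, hxa]
    obtain ⟨ζ, hζ⟩ : ∃ ζ : t ⟶ z, y = ζ ≫ j := Triangle.coyoneda_exact₂ _ Hw y
      (show y ≫ π = 0 by rw [hap, reassoc_of% hya, zero_comp])
    obtain ⟨η, hη⟩ := hq (ζ ≫ g) (by rw [Category.assoc, ← hja, ← Category.assoc, ← hζ, hya])
    obtain ⟨β, hβ⟩ := exists_lift_shift_mor₁ Hz (ζ⟦1⟧' - η ≫ φ) (by
      rw [Preadditive.sub_comp, ← Functor.map_comp, hη, Category.assoc, sub_self])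
    have hy' : y⟦1⟧' = β ≫ (ι ≫ j)⟦1⟧' := by
      rw [Functor.map_comp, ← Category.assoc, ← hβ, hζ, Functor.map_comp, Preadditive.sub_comp,
        Category.assoc, hφj, comp_zero, sub_zero]
    apply (shiftFunctor D (1 : ℤ)).map_injective
    rw [hy, Functor.map_comp, hy', Category.assoc, ← Functor.map_comp, hιjk, Functor.map_zero,
      Functor.map_zero, comp_zero]
  obtain ⟨b', hab', hqb'⟩ : ∃ b' : w₂ ⟶ c⟦(1 : ℤ)⟧, a ≫ b' = 0 ∧ q ≫ b' = h := by
    obtain ⟨t, τ, _, Ht⟩ := distinguished_cocone_triangle₁ (biprod.desc a q)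
    have hτ : τ ≫ biprod.desc a q = 0 := comp_distTriang_mor_zero₁₂ _ Ht
    obtain ⟨b', hb'⟩ : ∃ b', biprod.desc 0 h = biprod.desc a q ≫ b' := by
      refine Triangle.yoneda_exact₂ _ Ht (biprod.desc 0 h) (show τ ≫ biprod.desc 0 h = 0 from ?_)
      have hτ' : (τ ≫ biprod.fst) ≫ a + (τ ≫ biprod.snd) ≫ q = 0 := by
        simpa [biprod.desc_eq] using hτ
      suffices hs : (τ ≫ biprod.snd) ≫ h = 0 by simpa [biprod.desc_eq] using hs
      generalize τ ≫ biprod.fst = y at hτ'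
      generalize τ ≫ biprod.snd = s at hτ'
      obtain ⟨ζ, hζ⟩ : ∃ ζ : t ⟶ z, y = ζ ≫ j := Triangle.coyoneda_exact₂ _ Hw y
        (show y ≫ π = 0 by simpa [Preadditive.add_comp, hqp, ← hap] using hτ' =≫ p)
      obtain ⟨η, hη⟩ := hq (ζ ≫ g + s) (by
        rw [Preadditive.add_comp, Category.assoc, ← hja, ← Category.assoc, ← hζ, hτ'])
      have hs : s = (ζ ≫ g + s) - ζ ≫ g := by abel
      apply (shiftFunctor D (1 : ℤ)).map_injective
      have hgh' : g⟦(1 : ℤ)⟧' ≫ h⟦1⟧' = 0 := by rw [← Functor.map_comp, hgh, Functor.map_zero]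
      rw [hs, Preadditive.sub_comp, Category.assoc, hgh, comp_zero, sub_zero, Functor.map_comp,
        hη, Category.assoc, Category.assoc, hgh', comp_zero, comp_zero, Functor.map_zero]
    exact ⟨b', by simpa using (biprod.inl ≫= hb').symm, by simpa using (biprod.inr ≫= hb').symm⟩
  obtain ⟨b, hb⟩ := exists_lift_shift_mor₁ Hz (p ≫ φ) (by rw [Category.assoc, hpφg])
  obtain ⟨V, e, d, HV⟩ := distinguished_cocone_triangle (biprod.lift a' m)
  have hd : d = 0 := Triangle.mor₃_eq_zero_of_mono₁ _ HV hmono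
  have hse : biprod.lift a' m ≫ e = 0 := comp_distTriang_mor_zero₁₂ _ HV
  obtain ⟨i, -, -⟩ := exists_iso_binaryBiproduct_of_distTriang _ HV hd
  obtain ⟨r, hr⟩ : ∃ r : V ⟶ w₂ ⊞ c⟦(1 : ℤ)⟧, 𝟙 V = r ≫ e :=
    Triangle.coyoneda_exact₃ _ HV (𝟙 V) (show 𝟙 V ≫ d = 0 by rw [hd, comp_zero])
  refine ⟨w₁, w₂, V, ⟨_, _, _, H₁⟩, ⟨_, _, _, H₂⟩, ⟨i⟩, ?_⟩
  let ψ : V ⟶ (c⟦(1 : ℤ)⟧ ⊞ c⟦(1 : ℤ)⟧) ⊞ c⟦(1 : ℤ)⟧ :=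
    r ≫ biprod.lift (biprod.lift (biprod.fst ≫ b') (biprod.fst ≫ b)) biprod.snd
  suffices hψ : Mono ψ by
    have := isSplitMono_of_mono ψ
    exact ⟨ψ, retraction ψ, IsSplitMono.id ψ⟩
  refine (Preadditive.mono_iff_cancel_zero _).2 fun t x hx => ?_
  have h₁ : ((x ≫ r) ≫ biprod.fst) ≫ b' = 0 := by
    simpa [ψ] using (hx =≫ biprod.fst) =≫ biprod.fst
  have h₂ : ((x ≫ r) ≫ biprod.fst) ≫ b = 0 := by
    simpa [ψ] using (hx =≫ biprod.fst) =≫ biprod.snd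
  have h₃ : (x ≫ r) ≫ biprod.snd = 0 := by simpa [ψ] using hx =≫ biprod.snd
  obtain ⟨y, hy⟩ : ∃ y : t ⟶ w, ((x ≫ r) ≫ biprod.fst) ≫ p = y ≫ π :=
    Triangle.coyoneda_exact₃ _ Hw _ (show (((x ≫ r) ≫ biprod.fst) ≫ p) ≫ φ = 0 by
      rw [Category.assoc _ p, hb, ← Category.assoc, h₂, zero_comp])
  obtain ⟨s, hs⟩ : ∃ s : t ⟶ z', (x ≫ r) ≫ biprod.fst - y ≫ a = s ≫ q :=
    Triangle.coyoneda_exact₂ _ H₂ _ (show ((x ≫ r) ≫ biprod.fst - y ≫ a) ≫ p = 0 by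
      rw [Preadditive.sub_comp, hy, Category.assoc, ← hap, sub_self])
  have hsh : s ≫ h = 0 := by
    rw [← hqb', ← Category.assoc, ← hs, Preadditive.sub_comp, h₁, Category.assoc, hab', comp_zero,
      sub_zero]
  obtain ⟨ζ, hζ⟩ : ∃ ζ : t ⟶ z, s = ζ ≫ g := Triangle.coyoneda_exact₃ _ Hz s hsh
  have hω : (x ≫ r) ≫ biprod.fst = (y + ζ ≫ j) ≫ k ≫ a' := by
    rw [← ha', Preadditive.add_comp, Category.assoc ζ j a, hja, ← Category.assoc, ← hζ, ← hs]
    abel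
  have hxr : x ≫ r = ((y + ζ ≫ j) ≫ k) ≫ biprod.lift a' m := by
    apply biprod.hom_ext
    · rw [hω, Category.assoc, Category.assoc, biprod.lift_fst]
    · rw [h₃, Category.assoc, Category.assoc, biprod.lift_snd, hkm, comp_zero]
  rw [← Category.comp_id x, hr, ← Category.assoc, hxr, Category.assoc, hse, comp_zero]

end Triangles


section Coproducts

/-- A retract of `P` is absorbed by a countable coproduct of copies of `P`. -/
theorem IsDirectSummand.nonempty_biprod_sigma_iso {R P : C} (hR : IsDirectSummand R P) :
    Nonempty (R ⊞ (∐ fun _ : ULift.{v} ℕ => P) ≅ ∐ fun _ : ULift.{v} ℕ => P) := by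
  obtain ⟨i, r, hir⟩ := hR
  let inj (n : ℕ) : P ⟶ ∐ fun _ : ULift.{v} ℕ => P :=
    Sigma.ι (fun _ : ULift.{v} ℕ => P) ⟨n⟩
  let u : R ⊞ (∐ fun _ : ULift.{v} ℕ => P) ⟶ ∐ fun _ : ULift.{v} ℕ => P :=
    biprod.desc (i ≫ inj 0)
      (Sigma.desc fun n => (𝟙 P - r ≫ i) ≫ inj n.down + r ≫ i ≫ inj (n.down + 1))
  let d : ℕ → (P ⟶ R ⊞ ∐ fun _ : ULift.{v} ℕ => P) := fun n =>
    (𝟙 P - r ≫ i) ≫ inj n ≫ biprod.inr +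
      Nat.casesOn n (r ≫ biprod.inl) fun k => r ≫ i ≫ inj k ≫ biprod.inr
  let w : (∐ fun _ : ULift.{v} ℕ => P) ⟶ R ⊞ ∐ fun _ : ULift.{v} ℕ => P :=
    Sigma.desc fun n => d n.down
  have hu₁ : biprod.inl ≫ u = i ≫ inj 0 := biprod.inl_desc _ _
  have hu₂ (n : ℕ) : inj n ≫ biprod.inr ≫ u =
      (𝟙 P - r ≫ i) ≫ inj n + r ≫ i ≫ inj (n + 1) := by
    simp [u, inj]
  have hw (n : ℕ) : inj n ≫ w = d n := by simp [w, inj]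
  have hd₀ : d 0 = (𝟙 P - r ≫ i) ≫ inj 0 ≫ biprod.inr + r ≫ biprod.inl := rfl
  have hd₁ (n : ℕ) : d (n + 1) =
      (𝟙 P - r ≫ i) ≫ inj (n + 1) ≫ biprod.inr + r ≫ i ≫ inj n ≫ biprod.inr := rfl
  have hi : i ≫ (𝟙 P - r ≫ i) = 0 := by simp [reassoc_of% hir]
  have hr : (𝟙 P - r ≫ i) ≫ r = 0 := by simp [hir]
  have he : (𝟙 P - r ≫ i) ≫ (𝟙 P - r ≫ i) = 𝟙 P - r ≫ i := by simp [reassoc_of% hir]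
  have hadd {T : C} (f : P ⟶ T) : (𝟙 P - r ≫ i) ≫ f + r ≫ i ≫ f = f := by simp
  refine ⟨⟨u, w, ?_, ?_⟩⟩
  · refine biprod.hom_ext' _ _ ?_ (Sigma.hom_ext _ _ fun ⟨n⟩ => ?_)
    · rw [reassoc_of% hu₁, hw, hd₀, Preadditive.comp_add, reassoc_of% hi, reassoc_of% hir,
        zero_comp, zero_add, Category.comp_id]
    · change inj n ≫ biprod.inr ≫ u ≫ w = inj n ≫ biprod.inr ≫ 𝟙 _
      rw [← Category.assoc biprod.inr, ← Category.assoc, hu₂, Preadditive.add_comp,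
        Category.assoc, Category.assoc, Category.assoc, hw, hw, hd₁, Category.comp_id]
      conv_rhs => rw [← hadd (inj n ≫ biprod.inr)]
      congr 1
      · cases n with
        | zero =>
          rw [hd₀, Preadditive.comp_add, reassoc_of% he, reassoc_of% hr, zero_comp, add_zero]
        | succ n =>
          rw [hd₁, Preadditive.comp_add, reassoc_of% he, reassoc_of% hr, zero_comp, add_zero]
      · rw [Preadditive.comp_add, reassoc_of% hi, reassoc_of% hir, zero_comp, zero_add]
  · refine Sigma.hom_ext _ _ fun ⟨n⟩ => ?_
    change inj n ≫ w ≫ u = inj n ≫ 𝟙 _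
    rw [← Category.assoc, hw, Category.comp_id]
    cases n with
    | zero =>
      rw [hd₀, Preadditive.add_comp, Category.assoc, Category.assoc, Category.assoc, hu₁, hu₂,
        Preadditive.comp_add, reassoc_of% he, reassoc_of% hr, zero_comp, add_zero, hadd]
    | succ n =>
      rw [hd₁, Preadditive.add_comp, Category.assoc, Category.assoc, Category.assoc,
        Category.assoc, Category.assoc, hu₂, hu₂,
        Preadditive.comp_add, reassoc_of% he, reassoc_of% hr, zero_comp, add_zero,
        Preadditive.comp_add, reassoc_of% hi, reassoc_of% hir, zero_comp, zero_add, hadd]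

theorem nonempty_biprod_iso_sigma (x y : C) :
    Nonempty (x ⊞ y ≅ ∐ fun b : ULift.{v} Bool => cond b.down x y) := by
  let f : ULift.{v} Bool → C := fun b => cond b.down x y
  let d : (b : Bool) → (cond b x y ⟶ x ⊞ y) := fun b => match b with
    | true => biprod.inl
    | false => biprod.inr
  refine ⟨⟨biprod.desc (Sigma.ι f ⟨true⟩) (Sigma.ι f ⟨false⟩), Sigma.desc fun b => d b.down,
    ?_, ?_⟩⟩
  · refine biprod.hom_ext' _ _ ?_ ?_
    · rw [biprod.inl_desc_assoc, Category.comp_id]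
      exact Sigma.ι_desc (f := f) (fun b => d b.down) ⟨true⟩
    · rw [biprod.inr_desc_assoc, Category.comp_id]
      exact Sigma.ι_desc (f := f) (fun b => d b.down) ⟨false⟩
  · refine Sigma.hom_ext _ _ fun ⟨b⟩ => ?_
    rw [Sigma.ι_desc_assoc, Category.comp_id]
    cases b
    · exact biprod.inr_desc _ _
    · exact biprod.inl_desc _ _

theorem exists_desc_shift_sigma {J : Type v} (f : J → C) {t : C}
    (β : ∀ j, (f j)⟦(1 : ℤ)⟧ ⟶ t) :
    ∃ b : (∐ f)⟦(1 : ℤ)⟧ ⟶ t, ∀ j, (Sigma.ι f j)⟦(1 : ℤ)⟧' ≫ b = β j := by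
  refine ⟨inv (sigmaComparison (shiftFunctor C (1 : ℤ)) f) ≫ Sigma.desc β, fun j => ?_⟩
  rw [← ι_comp_sigmaComparison (shiftFunctor C (1 : ℤ)) f j]
  simp

theorem shift_sigma_hom_ext {J : Type v} (f : J → C) {t : C} {b b' : (∐ f)⟦(1 : ℤ)⟧ ⟶ t}
    (H : ∀ j, (Sigma.ι f j)⟦(1 : ℤ)⟧' ≫ b = (Sigma.ι f j)⟦(1 : ℤ)⟧' ≫ b') : b = b' := by
  rw [← cancel_epi (sigmaComparison (shiftFunctor C (1 : ℤ)) f)]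
  refine Sigma.hom_ext _ _ fun j => ?_
  rw [ι_comp_sigmaComparison_assoc, ι_comp_sigmaComparison_assoc, H]

theorem isDistTriple_sigma {J : Type v} {x y z : J → C}
    (H : ∀ j, IsDistTriple (x j) (y j) (z j)) : IsDistTriple (∐ x) (∐ y) (∐ z) := by
  choose f g h H using H
  obtain ⟨Z, p, q, HZ⟩ := distinguished_cocone_triangle (Limits.Sigma.map f)
  have hfg (j) : f j ≫ g j = 0 := comp_distTriang_mor_zero₁₂ _ (H j)
  have hqf : q ≫ (Limits.Sigma.map f)⟦(1 : ℤ)⟧' = 0 := comp_distTriang_mor_zero₃₁ _ HZ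
  have comm (j) : ∃ a : z j ⟶ Z, g j ≫ a = Sigma.ι y j ≫ p ∧
      h j ≫ (Sigma.ι x j)⟦1⟧' = a ≫ q :=
    complete_distinguished_triangle_morphism _ _ (H j) HZ (Sigma.ι x j) (Sigma.ι y j)
      (Sigma.ι_map f j).symm
  choose a hga haq using comm
  suffices hiso : IsIso (Sigma.desc a) from
    IsDistTriple.of_iso ⟨_, _, _, HZ⟩ (Iso.refl _) (Iso.refl _) (asIso (Sigma.desc a)).symm
  refine isIso_of_coyoneda_map_bijective _ fun t => ⟨fun s s' hs => ?_, fun s => ?_⟩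
  · rw [← sub_eq_zero]
    have hs₀ (j) : a j ≫ (s - s') = 0 := by
      have := Sigma.ι z j ≫= hs
      rw [Sigma.ι_desc_assoc, Sigma.ι_desc_assoc] at this
      rw [Preadditive.comp_sub, this, sub_self]
    generalize s - s' = s₀ at hs₀
    obtain ⟨s₁, rfl⟩ : ∃ s₁ : (∐ x)⟦(1 : ℤ)⟧ ⟶ t, s₀ = q ≫ s₁ :=
      Triangle.yoneda_exact₃ _ HZ s₀ (show p ≫ s₀ = 0 from Sigma.hom_ext _ _ fun j => by
        rw [← Category.assoc, ← hga, Category.assoc, hs₀, comp_zero, comp_zero])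
    have hβ (j) : ∃ β : (y j)⟦(1 : ℤ)⟧ ⟶ t, (Sigma.ι x j)⟦1⟧' ≫ s₁ = (-(f j)⟦1⟧') ≫ β :=
      Triangle.yoneda_exact₃ _ (rot_of_distTriang _ (H j)) ((Sigma.ι x j)⟦1⟧' ≫ s₁)
        (show h j ≫ (Sigma.ι x j)⟦1⟧' ≫ s₁ = 0 by
          rw [← Category.assoc, haq, Category.assoc, hs₀])
    choose β hβ using hβ
    obtain ⟨b, hb⟩ := exists_desc_shift_sigma y β
    have hs₁ : s₁ = (Limits.Sigma.map f)⟦(1 : ℤ)⟧' ≫ (-b) := shift_sigma_hom_ext x fun j => by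
      rw [← Category.assoc, ← Functor.map_comp, Sigma.ι_map, Functor.map_comp, Category.assoc,
        Preadditive.comp_neg, hb, hβ, Preadditive.neg_comp, Preadditive.comp_neg]
    rw [hs₁, ← Category.assoc, hqf, zero_comp]
  · obtain ⟨s₁, hs₁⟩ : ∃ s₁ : Z ⟶ t, Sigma.desc (fun j => g j ≫ Sigma.ι z j ≫ s) = p ≫ s₁ :=
      Triangle.yoneda_exact₂ _ HZ (Sigma.desc fun j => g j ≫ Sigma.ι z j ≫ s)
        (show Limits.Sigma.map f ≫ Sigma.desc (fun j => g j ≫ Sigma.ι z j ≫ s) = 0 from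
          Sigma.hom_ext _ _ fun j => by
            rw [Sigma.ι_map_assoc, Sigma.ι_desc, reassoc_of% hfg j, zero_comp, comp_zero])
    have hβ (j) : ∃ β : (x j)⟦(1 : ℤ)⟧ ⟶ t, Sigma.ι z j ≫ s - a j ≫ s₁ = h j ≫ β :=
      Triangle.yoneda_exact₃ _ (H j) (Sigma.ι z j ≫ s - a j ≫ s₁)
        (show g j ≫ (Sigma.ι z j ≫ s - a j ≫ s₁) = 0 by
          rw [Preadditive.comp_sub, reassoc_of% hga j, ← hs₁, Sigma.ι_desc, sub_self])
    choose β hβ using hβ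
    obtain ⟨b, hb⟩ := exists_desc_shift_sigma x β
    refine ⟨s₁ + q ≫ b, Sigma.hom_ext _ _ fun j => ?_⟩
    rw [Sigma.ι_desc_assoc, Preadditive.comp_add, ← Category.assoc (a j) q, ← haq,
      Category.assoc, hb, ← hβ]
    abel

theorem IsDistTriple.biprod {x y z x' y' z' : C} (H : IsDistTriple x y z)
    (H' : IsDistTriple x' y' z') : IsDistTriple (x ⊞ x') (y ⊞ y') (z ⊞ z') := by
  obtain ⟨e₁⟩ := nonempty_biprod_iso_sigma x x'
  obtain ⟨e₂⟩ := nonempty_biprod_iso_sigma y y'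
  obtain ⟨e₃⟩ := nonempty_biprod_iso_sigma z z'
  refine IsDistTriple.of_iso (isDistTriple_sigma fun b => ?_) e₁.symm e₂.symm e₃.symm
  obtain ⟨_ | _⟩ := b
  · exact H'
  · exact H

end Coproducts

section Closure

/-- The suspensions of the objects of `A`. -/
def suspSet (A : Set C) : Set C :=
  {x : C | ∃ a ∈ A, Nonempty (x ≅ a⟦(1 : ℤ)⟧)}

theorem mem_AddClos_of_iso {A : Set C} {x y : C} (hx : x ∈ AddClos A) (e : x ≅ y) :
    y ∈ AddClos A := by
  obtain ⟨J, f, hf, ⟨i⟩⟩ := hx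
  exact ⟨J, f, hf, ⟨e.symm ≪≫ i⟩⟩

theorem AddClos_mono {A B : Set C} (h : A ⊆ B) : AddClos A ⊆ AddClos B :=
  fun _ ⟨J, f, hf, e⟩ => ⟨J, f, fun j => h (hf j), e⟩

theorem zero_mem_AddClos (A : Set C) : (0 : C) ∈ AddClos A := by
  let f : PEmpty.{v + 1} → C := PEmpty.elim
  have hf : IsZero (∐ f) := (IsZero.iff_id_eq_zero _).2 (Sigma.hom_ext _ _ fun j => j.elim)
  exact ⟨PEmpty, f, fun j => j.elim, ⟨hf.isoZero.symm⟩⟩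

theorem sigma_mem_AddClos {A : Set C} {J : Type v} {x : J → C} (hx : ∀ j, x j ∈ AddClos A) :
    ∐ x ∈ AddClos A := by
  choose K f hf e using hx
  exact ⟨Σ j, K j, fun p => f p.1 p.2, fun p => hf p.1 p.2,
    ⟨Sigma.mapIso (fun j => (e j).some) ≪≫ sigmaSigmaIso K f⟩⟩

theorem biprod_mem_AddClos {A : Set C} {x y : C} (hx : x ∈ AddClos A) (hy : y ∈ AddClos A) :
    (x ⊞ y) ∈ AddClos A := by
  obtain ⟨e⟩ := nonempty_biprod_iso_sigma x y
  refine mem_AddClos_of_iso (sigma_mem_AddClos fun b => ?_) e.symm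
  obtain ⟨_ | _⟩ := b
  · exact hy
  · exact hx

theorem mem_AddClos_suspSet_iff {A : Set C} {x : C} :
    x ∈ AddClos (suspSet A) ↔ ∃ a ∈ AddClos A, Nonempty (x ≅ a⟦(1 : ℤ)⟧) := by
  constructor
  · rintro ⟨J, f, hf, ⟨e⟩⟩
    choose g hg i using hf
    exact ⟨∐ g, ⟨J, g, hg, ⟨Iso.refl _⟩⟩,
      ⟨e ≪≫ Sigma.mapIso (fun j => (i j).some) ≪≫
        (PreservesCoproduct.iso (shiftFunctor C (1 : ℤ)) g).symm⟩⟩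
  · rintro ⟨a, ⟨J, g, hg, ⟨i⟩⟩, ⟨e⟩⟩
    exact ⟨J, fun j => (g j)⟦(1 : ℤ)⟧, fun j => ⟨g j, hg j, ⟨Iso.refl _⟩⟩,
      ⟨e ≪≫ (shiftFunctor C (1 : ℤ)).mapIso i ≪≫
        PreservesCoproduct.iso (shiftFunctor C (1 : ℤ)) g⟩⟩

theorem mem_CoprodN_succ_iff {A : Set C} {n : ℕ} {y : C} :
    y ∈ CoprodN A (n + 1) ↔ ∃ x z, IsDistTriple x y z ∧ x ∈ AddClos A ∧ z ∈ CoprodN A n :=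
  ⟨fun ⟨x, z, f, g, h, H, hx, hz⟩ => ⟨x, z, ⟨f, g, h, H⟩, hx, hz⟩,
    fun ⟨x, z, ⟨f, g, h, H⟩, hx, hz⟩ => ⟨x, z, f, g, h, H, hx, hz⟩⟩

theorem mem_CoprodN_of_iso {A : Set C} {n : ℕ} {x y : C} (hx : x ∈ CoprodN A n) (e : x ≅ y) :
    y ∈ CoprodN A n := by
  cases n with
  | zero => exact IsZero.of_iso hx e.symm
  | succ n =>
    obtain ⟨a, z, H, ha, hz⟩ := mem_CoprodN_succ_iff.1 hx
    exact mem_CoprodN_succ_iff.2 ⟨a, z, H.of_iso (Iso.refl _) e (Iso.refl _), ha, hz⟩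

theorem CoprodN_mono {A B : Set C} (h : A ⊆ B) (n : ℕ) : CoprodN A n ⊆ CoprodN B n := by
  induction n with
  | zero => exact subset_rfl
  | succ n ih =>
    intro y hy
    obtain ⟨x, z, H, hx, hz⟩ := mem_CoprodN_succ_iff.1 hy
    exact mem_CoprodN_succ_iff.2 ⟨x, z, H, AddClos_mono h hx, ih hz⟩

theorem sigma_mem_CoprodN {A : Set C} {n : ℕ} {J : Type v} {y : J → C}
    (hy : ∀ j, y j ∈ CoprodN A n) : ∐ y ∈ CoprodN A n := by
  induction n generalizing y with
  | zero =>
    exact (IsZero.iff_id_eq_zero _).2 (Sigma.hom_ext _ _ fun j => IsZero.eq_of_src (hy j) _ _)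
  | succ n ih =>
    choose x z H hx hz using fun j => mem_CoprodN_succ_iff.1 (hy j)
    exact mem_CoprodN_succ_iff.2
      ⟨∐ x, ∐ z, isDistTriple_sigma H, sigma_mem_AddClos hx, ih hz⟩

theorem biprod_mem_CoprodN {A : Set C} {n : ℕ} {x y : C} (hx : x ∈ CoprodN A n)
    (hy : y ∈ CoprodN A n) : (x ⊞ y) ∈ CoprodN A n := by
  obtain ⟨e⟩ := nonempty_biprod_iso_sigma x y
  refine mem_CoprodN_of_iso (sigma_mem_CoprodN fun b => ?_) e.symm
  obtain ⟨_ | _⟩ := b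
  · exact hy
  · exact hx

theorem zero_mem_CoprodN (A : Set C) (n : ℕ) : (0 : C) ∈ CoprodN A n := by
  induction n with
  | zero => exact isZero_zero C
  | succ n ih =>
    exact mem_CoprodN_succ_iff.2 ⟨0, 0, isDistTriple_zero_left 0, zero_mem_AddClos A, ih⟩

theorem AddClos_subset_CoprodN (A : Set C) {n : ℕ} (hn : 1 ≤ n) : AddClos A ⊆ CoprodN A n := by
  obtain ⟨n, rfl⟩ := Nat.exists_eq_add_of_le' hn
  exact fun x hx =>
    mem_CoprodN_succ_iff.2 ⟨x, 0, isDistTriple_zero_right x, hx, zero_mem_CoprodN A n⟩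

theorem shift_mem_CoprodN_suspSet {A : Set C} {n : ℕ} {y : C} (hy : y ∈ CoprodN A n) :
    y⟦(1 : ℤ)⟧ ∈ CoprodN (suspSet A) n := by
  induction n generalizing y with
  | zero => exact Functor.map_isZero (shiftFunctor C (1 : ℤ)) hy
  | succ n ih =>
    obtain ⟨x, z, H, hx, hz⟩ := mem_CoprodN_succ_iff.1 hy
    exact mem_CoprodN_succ_iff.2 ⟨_, _, H.shift,
      mem_AddClos_suspSet_iff.2 ⟨x, hx, ⟨Iso.refl _⟩⟩, ih hz⟩

/-- An extension of an object of `Coprod_m(ΣA)` by an object of `Coprod_l(A)` lies in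
`Coprod_{l+m}(B)` as soon as `B` contains `A` and `ΣA`. -/
theorem mem_CoprodN_add {A B : Set C} (hA : A ⊆ B) (hA' : suspSet A ⊆ B) {l m : ℕ} (hm : 1 ≤ m)
    {z w W : C} (H : IsDistTriple z w W) (hz : z ∈ CoprodN A l)
    (hW : W ∈ CoprodN (suspSet A) m) : w ∈ CoprodN B (l + m) := by
  induction l generalizing z w W with
  | zero =>
    obtain ⟨e⟩ := H.nonempty_iso hz
    rw [zero_add]
    exact CoprodN_mono hA' m (mem_CoprodN_of_iso hW e.symm)
  | succ l ih =>
    obtain ⟨c, z', Hz, hc, hz'⟩ := mem_CoprodN_succ_iff.1 hz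
    obtain ⟨w₁, w₂, V, H₁, H₂, ⟨i⟩, hV⟩ := exists_iso_biprod_of_isDistTriple Hz H
    let P := (c⟦(1 : ℤ)⟧ ⊞ c⟦(1 : ℤ)⟧) ⊞ c⟦(1 : ℤ)⟧
    let Q := ∐ fun _ : ULift.{v} ℕ => P
    have hc' : c⟦(1 : ℤ)⟧ ∈ AddClos (suspSet A) :=
      mem_AddClos_suspSet_iff.2 ⟨c, hc, ⟨Iso.refl _⟩⟩
    have hQ : Q ∈ AddClos (suspSet A) :=
      sigma_mem_AddClos fun _ => biprod_mem_AddClos (biprod_mem_AddClos hc' hc') hc'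
    obtain ⟨e₁⟩ := hV.nonempty_biprod_sigma_iso
    obtain ⟨e₂⟩ := IsDirectSummand.nonempty_biprod_sigma_iso
      (show IsDirectSummand (c⟦(1 : ℤ)⟧) P from ⟨biprod.inr, biprod.snd, biprod.inr_snd⟩)
    have e : w₂ ⊞ Q ≅ w₁ ⊞ Q :=
      biprod.mapIso (Iso.refl _) e₂.symm ≪≫ (biprod.associator _ _ _).symm ≪≫
        biprod.mapIso i (Iso.refl _) ≪≫ biprod.associator _ _ _ ≪≫
        biprod.mapIso (Iso.refl _) e₁
    have hw₂ : (w₂ ⊞ Q) ∈ CoprodN B (l + m) :=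
      ih ((H₂.biprod (isDistTriple_zero_left Q)).of_iso (isoBiprodZero (isZero_zero C)).symm
        (Iso.refl _) (Iso.refl _)) hz'
        (biprod_mem_CoprodN hW (AddClos_subset_CoprodN _ hm hQ))
    obtain ⟨q, hq, ⟨i'⟩⟩ := mem_AddClos_suspSet_iff.1 hQ
    rw [Nat.succ_add]
    exact mem_CoprodN_succ_iff.2 ⟨c ⊞ q, w₁ ⊞ Q,
      (H₁.biprod (isDistTriple_zero_middle q)).of_iso (Iso.refl _)
        (isoBiprodZero (isZero_zero C)).symm (biprod.mapIso (Iso.refl _) i'.symm),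
      AddClos_mono hA (biprod_mem_AddClos hc hq), mem_CoprodN_of_iso hw₂ e⟩

end Closure


/-- **Statement 16.** Let `T` be a triangulated category with small coproducts, `B` a
full subcategory of `T`, and `l ≥ 1`. Then
`Coprod_l(B) ⊆ smd(Coprod_l(B)) ⊆ Coprod_{2l}(B[−1, 0])`. -/
theorem coprod_smd (B : Set C) (l : ℕ) (hl : 1 ≤ l) :
    CoprodN B l ⊆ smdSet (CoprodN B l) ∧
      smdSet (CoprodN B l) ⊆ CoprodN (windowZ B (-1) 0) (2 * l) := by
  refine ⟨fun x hx => ⟨x, hx, 𝟙 x, 𝟙 x, Category.comp_id _⟩, ?_⟩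
  rintro x ⟨y, hy, hxy⟩
  obtain ⟨e⟩ := hxy.nonempty_biprod_sigma_iso
  have hZ : (∐ fun _ : ULift.{v} ℕ => y) ∈ CoprodN B l := sigma_mem_CoprodN fun _ => hy
  have H := ((isDistTriple_biprod (∐ fun _ : ULift.{v} ℕ => y) x).of_iso (Iso.refl _)
    (biprod.braiding _ _ ≪≫ e) (Iso.refl _)).rotate
  rw [two_mul]
  refine mem_CoprodN_add ?_ ?_ hl H hZ (shift_mem_CoprodN_suspSet hZ)
  · exact fun b hb => ⟨b, 0, hb, by norm_num, le_rfl, ⟨((shiftFunctorZero C ℤ).app b).symm⟩⟩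
  · rintro _ ⟨b, hb, ⟨i⟩⟩
    exact ⟨b, -1, hb, le_rfl, by norm_num, ⟨i⟩⟩

end Stmt16
end

section
/- Let T be a triangulated category, A a full subcategory, l a positive integer, and m ≤ n possibly infinite integers. If T has small coproducts, then Coprod_l(A[m,n]) ⊆ ⟨A⟩̄_l^{[m,n]} ⊆ Coprod_{2l}(A[m−1,n]), where ⟨A⟩̄_l^{[m,n]} = smd(Coprod_l(A[m,n])). Likewise ⟨A⟩_l^{[m,n]} = smd(coprod_l(A[m,n])). -/
/-!
Statement 17: For a full subcategory `A` of a triangulated category with small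
coproducts, `l ≥ 1` and possibly infinite integers `m ≤ n`:
`Coprod_l(A[m,n]) ⊆ ⟨A⟩̄_l^{[m,n]} ⊆ Coprod_{2l}(A[m−1,n])`, where
`⟨A⟩̄_l^{[m,n]} = smd(Coprod_l(A[m,n]))`; likewise `⟨A⟩_l^{[m,n]} = smd(coprod_l(A[m,n]))`.
-/

open CategoryTheory Limits Pretriangulated ZeroObject

universe v u

namespace Stmt17

variable {C : Type u} [Category.{v} C] [HasZeroObject C] [Preadditive C]
  [HasShift C ℤ] [∀ n : ℤ, (shiftFunctor C n).Additive] [Pretriangulated C]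

/-- `x` is a direct summand of `y`. -/
def IsDirectSummand (x y : C) : Prop :=
  ∃ (i : x ⟶ y) (r : y ⟶ x), i ≫ r = 𝟙 x

/-- `smd(A)`: all direct summands in `C` of objects of `A`. -/
def smdSet (A : Set C) : Set C :=
  {x : C | ∃ a ∈ A, IsDirectSummand x a}

/-- `A * B`: objects `y` sitting in a distinguished triangle `x → y → z → Σx`
with `x ∈ A` and `z ∈ B`. -/
def setStar (A B : Set C) : Set C :=
  {y : C | ∃ (x z : C) (f : x ⟶ y) (g : y ⟶ z) (h : z ⟶ (x⟦(1 : ℤ)⟧ : C)),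
    (Triangle.mk f g h ∈ distTriang C) ∧ x ∈ A ∧ z ∈ B}

/-- The shift window `A[m,n] = ⋃_{m ≤ i ≤ n} A⟦−i⟧`, where `m` may be `−∞` and
`n` may be `+∞`. -/
def window (A : Set C) (m : WithBot ℤ) (n : WithTop ℤ) : Set C :=
  {x : C | ∃ (a : C) (i : ℤ), a ∈ A ∧ m ≤ (i : WithBot ℤ) ∧ (i : WithTop ℤ) ≤ n ∧
    Nonempty (x ≅ ((a⟦(-i : ℤ)⟧ : C)))}

variable [HasFiniteBiproducts C]

/-- `add(A)`: all finite coproducts of objects of `A`. -/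
def addClos (A : Set C) : Set C :=
  {x : C | ∃ (k : ℕ) (f : Fin k → C), (∀ j, f j ∈ A) ∧ Nonempty (x ≅ (⨁ f))}

/-- `coprod_l(A)`: `coprod_1(A) = add(A)` and `coprod_{l+1}(A) = add(A) * coprod_l(A)`. -/
def coprodN (A : Set C) : ℕ → Set C
  | 0 => {x : C | IsZero x}
  | l + 1 => setStar (addClos A) (coprodN A l)

/-- `⟨A⟩_l^{[m,n]}`: `⟨A⟩_1 = smd(add A[m,n])` and `⟨A⟩_{l+1} = smd(⟨A⟩_1 * ⟨A⟩_l)`. -/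
def genN (A : Set C) (m : WithBot ℤ) (n : WithTop ℤ) : ℕ → Set C
  | 0 => {x : C | IsZero x}
  | l + 1 => smdSet (setStar (smdSet (addClos (window A m n))) (genN A m n l))

variable [HasCoproducts.{v} C]

/-- `Add(A)`: all small coproducts of objects of `A`. -/
def AddClos (A : Set C) : Set C :=
  {x : C | ∃ (J : Type v) (f : J → C), (∀ j, f j ∈ A) ∧ Nonempty (x ≅ ∐ f)}

/-- `Coprod_l(A)`: `Coprod_1(A) = Add(A)` and `Coprod_{l+1}(A) = Add(A) * Coprod_l(A)`. -/
def CoprodN (A : Set C) : ℕ → Set C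
  | 0 => {x : C | IsZero x}
  | l + 1 => setStar (AddClos A) (CoprodN A l)

/-- `⟨A⟩̄_l^{[m,n]}`: `⟨A⟩̄_1 = smd(Add A[m,n])` and `⟨A⟩̄_{l+1} = smd(⟨A⟩̄_1 * ⟨A⟩̄_l)`. -/
def GenN (A : Set C) (m : WithBot ℤ) (n : WithTop ℤ) : ℕ → Set C
  | 0 => {x : C | IsZero x}
  | l + 1 => smdSet (setStar (smdSet (AddClos (window A m n))) (GenN A m n l))

set_option linter.unusedSectionVars false

section Retracts

theorem isDirectSummand_trans {x y z : C} (h : IsDirectSummand x y) (h' : IsDirectSummand y z) :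
    IsDirectSummand x z := by
  obtain ⟨i, r, hir⟩ := h
  obtain ⟨i', r', hir'⟩ := h'
  exact ⟨i ≫ i', r' ≫ r, by simp [reassoc_of% hir', hir]⟩

theorem subset_smdSet (P : Set C) : P ⊆ smdSet P :=
  fun x hx => ⟨x, hx, 𝟙 x, 𝟙 x, Category.id_comp _⟩

theorem smdSet_mono {P Q : Set C} (h : P ⊆ Q) : smdSet P ⊆ smdSet Q :=
  fun _ ⟨a, ha, hx⟩ => ⟨a, h ha, hx⟩

theorem smdSet_smdSet (P : Set C) : smdSet (smdSet P) = smdSet P := by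
  refine Set.Subset.antisymm ?_ (subset_smdSet _)
  rintro x ⟨y, ⟨z, hz, hyz⟩, hxy⟩
  exact ⟨z, hz, isDirectSummand_trans hxy hyz⟩

theorem smdSet_isZero : smdSet {x : C | IsZero x} = {x : C | IsZero x} := by
  refine Set.Subset.antisymm ?_ (subset_smdSet _)
  rintro x ⟨z, hz, i, r, h⟩
  exact (IsZero.iff_id_eq_zero x).2 (by rw [← h, hz.eq_of_tgt i 0, zero_comp])

/-- A direct summand has a complement. -/
theorem exists_complement {x y : C} (i : x ⟶ y) (r : y ⟶ x) (h : i ≫ r = 𝟙 x) :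
    ∃ (z : C) (e : y ≅ x ⊞ z), i ≫ e.hom = biprod.inl := by
  obtain ⟨z, p, q, hT⟩ := distinguished_cocone_triangle i
  have : IsSplitMono i := ⟨⟨r, h⟩⟩
  have hq : q = 0 := (Triangle.mor₃_eq_zero_iff_mono₁ _ hT).2 (inferInstanceAs (Mono i))
  obtain ⟨e, he, -⟩ := exists_iso_binaryBiproduct_of_distTriang _ hT hq
  exact ⟨z, e, he⟩

end Retracts

/-- `P` is closed under isomorphisms. -/
def IsoClosed (P : Set C) : Prop :=
  ∀ ⦃x y : C⦄, (x ≅ y) → x ∈ P → y ∈ P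

theorem isoClosed_isZero : IsoClosed {x : C | IsZero x} :=
  fun _ _ e hx => IsZero.of_iso hx e.symm

theorem isoClosed_setStar (P Q : Set C) : IsoClosed (setStar P Q) := by
  rintro y y' e ⟨x, z, f, g, h, hT, hx, hz⟩
  exact ⟨x, z, f ≫ e.hom, e.inv ≫ g, h, isomorphic_distinguished _ hT _
    (Triangle.isoMk _ (Triangle.mk f g h) (Iso.refl x) e.symm
      (Iso.refl z) (by simp [Triangle.mk]) (by simp [Triangle.mk]) (by simp [Triangle.mk])), hx, hz⟩

theorem setStar_mono {P P' Q Q' : Set C} (h : P ⊆ P') (h' : Q ⊆ Q') :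
    setStar P Q ⊆ setStar P' Q' :=
  fun _ ⟨x, z, f, g, k, hT, hx, hz⟩ => ⟨x, z, f, g, k, hT, h hx, h' hz⟩

section Exactness

variable {x y z w : C} {f : x ⟶ y} {g : y ⟶ z} {h : z ⟶ x⟦(1 : ℤ)⟧}

theorem exists_desc₂ (hT : Triangle.mk f g h ∈ distTriang C) (k : y ⟶ w) (hk : f ≫ k = 0) :
    ∃ m : z ⟶ w, k = g ≫ m :=
  Triangle.yoneda_exact₂ _ hT k hk

theorem exists_desc₃ (hT : Triangle.mk f g h ∈ distTriang C) (k : z ⟶ w) (hk : g ≫ k = 0) :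
    ∃ m : x⟦(1 : ℤ)⟧ ⟶ w, k = h ≫ m :=
  Triangle.yoneda_exact₃ _ hT k hk

theorem exists_desc_shift (hT : Triangle.mk f g h ∈ distTriang C) (k : x⟦(1 : ℤ)⟧ ⟶ w)
    (hk : h ≫ k = 0) : ∃ m : y⟦(1 : ℤ)⟧ ⟶ w, k = f⟦(1 : ℤ)⟧' ≫ m := by
  obtain ⟨m, hm⟩ : ∃ m : y⟦(1 : ℤ)⟧ ⟶ w, k = (-f⟦(1 : ℤ)⟧') ≫ m :=
    Triangle.yoneda_exact₃ _ (rot_of_distTriang _ hT) k hk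
  exact ⟨-m, by rw [hm]; simp⟩

theorem exists_lift_shift (hT : Triangle.mk f g h ∈ distTriang C) (k : w ⟶ y⟦(1 : ℤ)⟧)
    (hk : k ≫ g⟦(1 : ℤ)⟧' = 0) : ∃ m : w ⟶ x⟦(1 : ℤ)⟧, k = m ≫ f⟦(1 : ℤ)⟧' := by
  obtain ⟨m, hm⟩ : ∃ m : w ⟶ x⟦(1 : ℤ)⟧, k = m ≫ (-f⟦(1 : ℤ)⟧') :=
    Triangle.coyoneda_exact₁ _ (rot_of_distTriang _ hT) k hk
  exact ⟨-m, by rw [hm]; simp⟩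

/-- A morphism out of the first object of a triangle extends to the second object as soon as its
shift is killed by the connecting morphism. -/
theorem exists_extension (hT : Triangle.mk f g h ∈ distTriang C) (k : x ⟶ w)
    (hk : h ≫ k⟦(1 : ℤ)⟧' = 0) : ∃ m : y ⟶ w, f ≫ m = k := by
  obtain ⟨m, hm⟩ := exists_desc_shift hT _ hk
  obtain ⟨m, rfl⟩ := (shiftFunctor C (1 : ℤ)).map_surjective m
  exact ⟨m, (shiftFunctor C (1 : ℤ)).map_injective (by rw [hm, Functor.map_comp])⟩

variable {x' y' z' : C} {f' : x' ⟶ y'} {g' : y' ⟶ z'} {h' : z' ⟶ x'⟦(1 : ℤ)⟧}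

theorem exists_hom₃ (hT : Triangle.mk f g h ∈ distTriang C)
    (hT' : Triangle.mk f' g' h' ∈ distTriang C) (a : x ⟶ x') (b : y ⟶ y')
    (comm : f ≫ b = a ≫ f') :
    ∃ c : z ⟶ z', g ≫ c = b ≫ g' ∧ h ≫ a⟦(1 : ℤ)⟧' = c ≫ h' :=
  complete_distinguished_triangle_morphism _ _ hT hT' a b comm

theorem exists_hom₂ (hT : Triangle.mk f g h ∈ distTriang C)
    (hT' : Triangle.mk f' g' h' ∈ distTriang C) (a : x ⟶ x') (c : z ⟶ z')
    (comm : h ≫ a⟦(1 : ℤ)⟧' = c ≫ h') :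
    ∃ b : y ⟶ y', f ≫ b = a ≫ f' ∧ g ≫ c = b ≫ g' :=
  complete_distinguished_triangle_morphism₂ _ _ hT hT' a c comm

end Exactness

/-- The cones of the two ways of composing in an octahedron agree up to morphisms factoring
through `a⟦1⟧`. The octahedral axiom is not used. -/
theorem exists_equiv_modulo_shift {a b a' x c d e : C}
    {f : a ⟶ b} {g : b ⟶ a'} {h : a' ⟶ a⟦(1 : ℤ)⟧} (h₁ : Triangle.mk f g h ∈ distTriang C)
    {p : b ⟶ x} {q : x ⟶ c} {s : c ⟶ b⟦(1 : ℤ)⟧} (h₂ : Triangle.mk p q s ∈ distTriang C)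
    {d₂ : x ⟶ d} {d₃ : d ⟶ a⟦(1 : ℤ)⟧} (h₃ : Triangle.mk (f ≫ p) d₂ d₃ ∈ distTriang C)
    {e₁ : a' ⟶ e} {e₂ : e ⟶ c} (h₄ : Triangle.mk e₁ e₂ (s ≫ g⟦(1 : ℤ)⟧') ∈ distTriang C) :
    ∃ (k : e ⟶ d) (k' : d ⟶ e) (y₁ : d ⟶ a⟦(1 : ℤ)⟧) (x₁ : a⟦(1 : ℤ)⟧ ⟶ d)
      (y₂ : e ⟶ a⟦(1 : ℤ)⟧) (x₂ : a⟦(1 : ℤ)⟧ ⟶ e),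
      k' ≫ k + y₁ ≫ x₁ = 𝟙 d ∧ k ≫ k' + y₂ ≫ x₂ = 𝟙 e := by
  have z₁ : f ≫ g = 0 := comp_distTriang_mor_zero₁₂ _ h₁
  have z₂ : s ≫ p⟦(1 : ℤ)⟧' = 0 := comp_distTriang_mor_zero₃₁ _ h₂
  have z₄ : e₂ ≫ s ≫ g⟦(1 : ℤ)⟧' = 0 := comp_distTriang_mor_zero₂₃ _ h₄
  obtain ⟨l, hl, hl'⟩ : ∃ l : a' ⟶ d, g ≫ l = p ≫ d₂ ∧ h = l ≫ d₃ := by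
    obtain ⟨l, hl, hl'⟩ := exists_hom₃ h₁ h₃ (𝟙 a) p (by simp)
    exact ⟨l, hl, by simpa using hl'⟩
  obtain ⟨u, hu, hu'⟩ : ∃ u : x ⟶ e, p ≫ u = g ≫ e₁ ∧ q = u ≫ e₂ := by
    obtain ⟨u, hu, hu'⟩ := exists_hom₂ h₂ h₄ g (𝟙 c) (by simp)
    exact ⟨u, hu, by simpa using hu'⟩
  obtain ⟨k', hk₁, hk₂⟩ : ∃ k' : d ⟶ e, l ≫ k' = e₁ ∧ d₂ ≫ k' = u := by
    obtain ⟨k₀, hk₀⟩ := exists_desc₂ h₃ u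
      (by rw [Category.assoc, hu, reassoc_of% z₁, zero_comp])
    obtain ⟨w, hw⟩ := exists_desc₃ h₁ (l ≫ k₀ - e₁)
      (by rw [Preadditive.comp_sub, reassoc_of% hl, ← hk₀, hu, sub_self])
    have z₃ : d₂ ≫ d₃ = 0 := comp_distTriang_mor_zero₂₃ _ h₃
    exact ⟨k₀ - d₃ ≫ w, by rw [Preadditive.comp_sub, ← reassoc_of% hl', ← hw]; abel,
      by rw [Preadditive.comp_sub, reassoc_of% z₃, zero_comp, sub_zero, hk₀]⟩
  obtain ⟨k, hk₃, hk₄⟩ : ∃ k : e ⟶ d, e₁ ≫ k = l ∧ u ≫ k = d₂ := by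
    obtain ⟨k₀, hk₀⟩ := exists_extension h₄ l (by
      rw [Category.assoc, ← Functor.map_comp, hl, Functor.map_comp, reassoc_of% z₂, zero_comp])
    obtain ⟨w, hw⟩ := exists_desc₂ h₂ (u ≫ k₀ - d₂)
      (by rw [Preadditive.comp_sub, reassoc_of% hu, hk₀, hl, sub_self])
    have z₅ : e₁ ≫ e₂ = 0 := comp_distTriang_mor_zero₁₂ _ h₄
    exact ⟨k₀ - e₂ ≫ w, by rw [Preadditive.comp_sub, reassoc_of% z₅, zero_comp, sub_zero, hk₀],
      by rw [Preadditive.comp_sub, ← reassoc_of% hu', ← hw]; abel⟩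
  obtain ⟨x₁, hx₁⟩ := exists_desc₃ h₃ (𝟙 d - k' ≫ k)
    (by rw [Preadditive.comp_sub, reassoc_of% hk₂, hk₄, Category.comp_id, sub_self])
  obtain ⟨w, hw⟩ := exists_desc₂ h₄ (𝟙 e - k ≫ k')
    (by rw [Preadditive.comp_sub, reassoc_of% hk₃, hk₁, Category.comp_id, sub_self])
  obtain ⟨v, hv⟩ := exists_desc₃ h₂ w (by
    rw [hu', Category.assoc, ← hw, Preadditive.comp_sub, reassoc_of% hk₄, hk₂, Category.comp_id,
      sub_self])
  obtain ⟨t, ht⟩ := exists_lift_shift h₁ (e₂ ≫ s) (by rw [Category.assoc, z₄])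
  refine ⟨k, k', d₃, x₁, t, f⟦(1 : ℤ)⟧' ≫ v, by rw [← hx₁]; abel, ?_⟩
  rw [← reassoc_of% ht, ← hv, ← hw]
  abel

section Coproducts

/-- The Eilenberg swindle. -/
theorem swindle {x y : C} (h : IsDirectSummand x y) :
    Nonempty ((x ⊞ ∐ fun _ : ULift.{v} ℕ => y) ≅ ∐ fun _ : ULift.{v} ℕ => y) := by
  obtain ⟨i, r, hir⟩ := h
  let ι (n : ℕ) : y ⟶ ∐ fun _ : ULift.{v} ℕ => y := Sigma.ι (fun _ : ULift.{v} ℕ => y) ⟨n⟩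
  refine ⟨⟨biprod.desc (i ≫ ι 0)
      (Sigma.desc fun j => r ≫ i ≫ ι (j.down + 1) + (𝟙 y - r ≫ i) ≫ ι j.down),
    Sigma.desc fun j => Nat.casesOn j.down
      (r ≫ biprod.inl + ((𝟙 y - r ≫ i) ≫ ι 0) ≫ biprod.inr)
      (fun n => (r ≫ i ≫ ι n + (𝟙 y - r ≫ i) ≫ ι (n + 1)) ≫ biprod.inr), ?_, ?_⟩⟩
  · ext ⟨_ | n⟩ <;> simp [ι, reassoc_of% hir]
  · ext ⟨_ | n⟩ <;> simp [ι, reassoc_of% hir]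

/-- Objects isomorphic modulo morphisms factoring through `s` become isomorphic after adding
copies of `s`. -/
theorem exists_stable_iso {d e s : C} (k : e ⟶ d) (k' : d ⟶ e)
    (y₁ : d ⟶ s) (x₁ : s ⟶ d) (y₂ : e ⟶ s) (x₂ : s ⟶ e)
    (h₁ : k' ≫ k + y₁ ≫ x₁ = 𝟙 d) (h₂ : k ≫ k' + y₂ ≫ x₂ = 𝟙 e) :
    Nonempty ((d ⊞ ∐ fun _ : ULift.{v} ℕ => s ⊞ (s ⊞ s)) ≅
      (e ⊞ ∐ fun _ : ULift.{v} ℕ => s ⊞ (s ⊞ s))) := by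
  let i : d ⟶ e ⊞ s := biprod.lift k' y₁
  let r : e ⊞ s ⟶ d := biprod.desc k x₁
  have hir : i ≫ r = 𝟙 d := by simp [i, r, biprod.lift_desc, h₁]
  let α : e ⊞ s ⟶ s ⊞ (s ⊞ s) := biprod.lift (biprod.fst ≫ y₂)
    (biprod.lift (-(biprod.fst ≫ k ≫ y₁) + biprod.snd ≫ (𝟙 s - x₁ ≫ y₁)) biprod.snd)
  let β : s ⊞ (s ⊞ s) ⟶ e ⊞ s := biprod.desc (x₂ ≫ biprod.inl)
    (biprod.desc biprod.inr (-(x₁ ≫ k' ≫ biprod.inl)))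
  have hαβ : r ≫ i + α ≫ β = 𝟙 _ := by
    ext <;> simp [r, i, α, β, biprod.lift_desc, h₂]
  obtain ⟨z, w, hw⟩ := exists_complement i r hir
  have hi : i ≫ w.hom ≫ biprod.snd = 0 := by rw [reassoc_of% hw, biprod.inl_snd]
  have hz : IsDirectSummand z (s ⊞ (s ⊞ s)) := by
    refine ⟨biprod.inr ≫ w.inv ≫ α, β ≫ w.hom ≫ biprod.snd, ?_⟩
    have : α ≫ β = 𝟙 _ - r ≫ i := by rw [← hαβ]; abel
    simp only [Category.assoc, reassoc_of% this]
    simp [hi]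
  obtain ⟨t₁⟩ := swindle.{v} hz
  obtain ⟨t₂⟩ := swindle.{v} (x := s) (y := s ⊞ (s ⊞ s)) ⟨biprod.inl, biprod.fst, by simp⟩
  exact ⟨biprod.mapIso (Iso.refl _) t₁.symm ≪≫ (biprod.associator _ _ _).symm ≪≫
    biprod.mapIso w.symm (Iso.refl _) ≪≫ biprod.associator _ _ _ ≪≫
    biprod.mapIso (Iso.refl _) t₂⟩

variable {J : Type v}

/-- The shift of a coproduct is a coproduct of the shifts. -/
theorem exists_isColimit_shift (x : J → C) :
    Nonempty (IsColimit (Cofan.mk ((∐ x)⟦(1 : ℤ)⟧) fun j => (Sigma.ι x j)⟦(1 : ℤ)⟧')) :=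
  ⟨isColimitCofanMkObjOfIsColimit (shiftFunctor C (1 : ℤ)) x (Sigma.ι x)
    (coproductIsCoproduct x)⟩

/-- The cone of a coproduct of morphisms is the coproduct of the cones. -/
theorem exists_distinguished_coproduct {x y z : J → C} {f : ∀ j, x j ⟶ y j}
    {g : ∀ j, y j ⟶ z j} {h : ∀ j, z j ⟶ (x j)⟦(1 : ℤ)⟧}
    (hT : ∀ j, Triangle.mk (f j) (g j) (h j) ∈ distTriang C) :
    ∃ (k : C) (p : ∐ y ⟶ k) (q : k ⟶ (∐ x)⟦(1 : ℤ)⟧),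
      Triangle.mk (Limits.Sigma.map f) p q ∈ distTriang C ∧ Nonempty (k ≅ ∐ z) := by
  obtain ⟨k, p, q, hk⟩ := distinguished_cocone_triangle (Limits.Sigma.map f)
  refine ⟨k, p, q, hk, ?_⟩
  have key : ∀ j, ∃ φ : z j ⟶ k, g j ≫ φ = Sigma.ι y j ≫ p ∧
      h j ≫ (Sigma.ι x j)⟦(1 : ℤ)⟧' = φ ≫ q := fun j =>
    exists_hom₃ (hT j) hk (Sigma.ι x j) (Sigma.ι y j) (by simp)
  choose φ hφ hφ' using key
  obtain ⟨cx⟩ := exists_isColimit_shift x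
  obtain ⟨cy⟩ := exists_isColimit_shift y
  have zero_of (w : C) (m : k ⟶ w) (hm : ∀ j, φ j ≫ m = 0) : m = 0 := by
    obtain ⟨b, hb⟩ := exists_desc₃ hk m (Sigma.hom_ext _ _ fun j => by
      rw [← reassoc_of% hφ j, hm, comp_zero, comp_zero])
    have hb' (j : J) : ∃ c : (y j)⟦(1 : ℤ)⟧ ⟶ w,
        (Sigma.ι x j)⟦(1 : ℤ)⟧' ≫ b = (f j)⟦(1 : ℤ)⟧' ≫ c :=
      exists_desc_shift (hT j) _ (by rw [reassoc_of% hφ' j, ← hb, hm])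
    choose c hc using hb'
    have : b = (Limits.Sigma.map f)⟦(1 : ℤ)⟧' ≫ Cofan.IsColimit.desc cy c := by
      refine Cofan.IsColimit.hom_ext cx _ _ fun j => ?_
      have := Cofan.IsColimit.fac cy c j
      dsimp at this ⊢
      rw [hc, ← Functor.map_comp_assoc, Sigma.ι_map, Functor.map_comp, Category.assoc, this]
    have hz : q ≫ (Limits.Sigma.map f)⟦(1 : ℤ)⟧' = 0 := comp_distTriang_mor_zero₃₁ _ hk
    rw [hb, this, reassoc_of% hz, zero_comp]
  have exists_desc (w : C) (m : ∀ j, z j ⟶ w) : ∃ n : k ⟶ w, ∀ j, φ j ≫ n = m j := by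
    obtain ⟨n, hn⟩ := exists_desc₂ hk (Sigma.desc fun j => g j ≫ m j)
      (Sigma.hom_ext _ _ fun j => by
        have : f j ≫ g j = 0 := comp_distTriang_mor_zero₁₂ _ (hT j)
        simp [reassoc_of% this])
    have hn' (j : J) : ∃ c : (x j)⟦(1 : ℤ)⟧ ⟶ w, φ j ≫ n - m j = h j ≫ c :=
      exists_desc₃ (hT j) _ (by
        rw [Preadditive.comp_sub, reassoc_of% hφ j, ← hn]
        simp)
    choose c hc using hn'
    refine ⟨n - q ≫ Cofan.IsColimit.desc cx c, fun j => ?_⟩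
    have := Cofan.IsColimit.fac cx c j
    dsimp at this
    rw [Preadditive.comp_sub, ← reassoc_of% hφ' j, this, ← hc]
    abel
  obtain ⟨n, hn⟩ := exists_desc (∐ z) (Sigma.ι z)
  refine ⟨⟨n, Sigma.desc φ, ?_, Sigma.hom_ext _ _ fun j => by simp [hn]⟩⟩
  rw [← sub_eq_zero]
  exact zero_of _ _ fun j => by simp [Preadditive.comp_sub, reassoc_of% hn j]

theorem coproduct_mem_setStar {P Q : Set C} (hQ : IsoClosed Q) {x y z : J → C}
    {f : ∀ j, x j ⟶ y j} {g : ∀ j, y j ⟶ z j} {h : ∀ j, z j ⟶ (x j)⟦(1 : ℤ)⟧}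
    (hT : ∀ j, Triangle.mk (f j) (g j) (h j) ∈ distTriang C) (hx : ∐ x ∈ P) (hz : ∐ z ∈ Q) :
    ∐ y ∈ setStar P Q := by
  obtain ⟨k, p, q, hk, ⟨e⟩⟩ := exists_distinguished_coproduct hT
  exact ⟨_, _, _, _, _, hk, hx, hQ e.symm hz⟩

/-- A binary biproduct is a coproduct indexed by a type in an arbitrary universe. -/
theorem exists_iso_coproduct_bool (x : Bool → C) :
    Nonempty ((∐ fun j : ULift.{v} Bool => x j.down) ≅ x true ⊞ x false) := by
  refine ⟨⟨Sigma.desc fun j => Bool.rec biprod.inr biprod.inl j.down,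
    biprod.desc (Sigma.ι (fun j : ULift.{v} Bool => x j.down) ⟨true⟩)
      (Sigma.ι (fun j : ULift.{v} Bool => x j.down) ⟨false⟩), ?_, ?_⟩⟩
  · ext ⟨_ | _⟩ <;> simp
  · ext <;> simp

theorem biprod_mem_setStar {P Q : Set C} (hP : IsoClosed P) (hQ : IsoClosed Q)
    {x y z : C} {f : x ⟶ y} {g : y ⟶ z} {h : z ⟶ x⟦(1 : ℤ)⟧}
    (hT : Triangle.mk f g h ∈ distTriang C)
    {x' y' z' : C} {f' : x' ⟶ y'} {g' : y' ⟶ z'} {h' : z' ⟶ x'⟦(1 : ℤ)⟧}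
    (hT' : Triangle.mk f' g' h' ∈ distTriang C) (hx : (x ⊞ x') ∈ P) (hz : (z ⊞ z') ∈ Q) :
    (y ⊞ y') ∈ setStar P Q := by
  let T (b : Bool) : Triangle C := cond b (Triangle.mk f g h) (Triangle.mk f' g' h')
  have hTb (b : Bool) : T b ∈ distTriang C := by cases b <;> assumption
  obtain ⟨e₁⟩ := exists_iso_coproduct_bool.{v} fun b => (T b).obj₁
  obtain ⟨e₂⟩ := exists_iso_coproduct_bool.{v} fun b => (T b).obj₂
  obtain ⟨e₃⟩ := exists_iso_coproduct_bool.{v} fun b => (T b).obj₃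
  exact isoClosed_setStar P Q e₂ (coproduct_mem_setStar hQ
    (fun j : ULift.{v} Bool => hTb j.down) (hP e₁.symm hx) (hQ e₃.symm hz))

theorem smdSet_setStar_smdSet {P Q : Set C} (hP : IsoClosed P) (hQ : IsoClosed Q) :
    smdSet (setStar (smdSet P) (smdSet Q)) = smdSet (setStar P Q) := by
  refine Set.Subset.antisymm ?_
    (smdSet_mono (setStar_mono (subset_smdSet P) (subset_smdSet Q)))
  rw [← smdSet_smdSet (setStar P Q)]
  refine smdSet_mono ?_
  rintro y ⟨x, z, f, g, h, hT, ⟨a, ha, i, r, hir⟩, ⟨b, hb, i', r', hir'⟩⟩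
  obtain ⟨x', e, -⟩ := exists_complement i r hir
  obtain ⟨z', e', -⟩ := exists_complement i' r' hir'
  exact ⟨_, biprod_mem_setStar hP hQ hT (binaryBiproductTriangle_distinguished x' z')
    (hP e ha) (hQ e' hb), biprod.inl, biprod.fst, by simp⟩

end Coproducts

section Closures

theorem isoClosed_addClos (W : Set C) : IsoClosed (addClos W) :=
  fun _ _ e ⟨k, f, hf, ⟨e'⟩⟩ => ⟨k, f, hf, ⟨e.symm ≪≫ e'⟩⟩

theorem isoClosed_coprodN (W : Set C) : ∀ l, IsoClosed (coprodN W l)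
  | 0 => isoClosed_isZero
  | _ + 1 => isoClosed_setStar _ _

theorem genN_eq_smdSet (A : Set C) (m : WithBot ℤ) (n : WithTop ℤ) (l : ℕ) :
    genN A m n l = smdSet (coprodN (window A m n) l) := by
  induction l with
  | zero => exact smdSet_isZero.symm
  | succ l ih =>
    rw [genN, ih, smdSet_setStar_smdSet (isoClosed_addClos _) (isoClosed_coprodN _ l), coprodN]

theorem isoClosed_AddClos (W : Set C) : IsoClosed (AddClos W) :=
  fun _ _ e ⟨k, f, hf, ⟨e'⟩⟩ => ⟨k, f, hf, ⟨e.symm ≪≫ e'⟩⟩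

theorem isoClosed_CoprodN (W : Set C) : ∀ l, IsoClosed (CoprodN W l)
  | 0 => isoClosed_isZero
  | _ + 1 => isoClosed_setStar _ _

theorem GenN_eq_smdSet (A : Set C) (m : WithBot ℤ) (n : WithTop ℤ) (l : ℕ) :
    GenN A m n l = smdSet (CoprodN (window A m n) l) := by
  induction l with
  | zero => exact smdSet_isZero.symm
  | succ l ih =>
    rw [GenN, ih, smdSet_setStar_smdSet (isoClosed_AddClos _) (isoClosed_CoprodN _ l), CoprodN]

theorem coproduct_mem_AddClos {W : Set C} {J : Type v} {x : J → C} (hx : ∀ j, x j ∈ AddClos W) :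
    ∐ x ∈ AddClos W := by
  choose K f hf e using hx
  exact ⟨Σ j, K j, fun p => f p.1 p.2, fun p => hf p.1 p.2,
    ⟨Limits.Sigma.mapIso (fun j => (e j).some) ≪≫ sigmaSigmaIso K f⟩⟩

theorem coproduct_mem_CoprodN {W : Set C} {J : Type v} (l : ℕ) {x : J → C}
    (hx : ∀ j, x j ∈ CoprodN W l) : ∐ x ∈ CoprodN W l := by
  induction l generalizing x with
  | zero => exact (IsZero.iff_id_eq_zero _).2 (Sigma.hom_ext _ _ fun j => (hx j).eq_of_src _ _)
  | succ l ih =>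
    choose a b f g h hT ha hb using hx
    exact coproduct_mem_setStar (isoClosed_CoprodN W l) hT (coproduct_mem_AddClos ha) (ih hb)

theorem biprod_mem_of_coproduct_mem {P : Set C} (hP : IsoClosed P)
    (h : ∀ x : ULift.{v} Bool → C, (∀ j, x j ∈ P) → ∐ x ∈ P) {x y : C} (hx : x ∈ P)
    (hy : y ∈ P) : (x ⊞ y) ∈ P := by
  obtain ⟨e⟩ := exists_iso_coproduct_bool.{v} fun b => cond b x y
  exact hP e (h _ (by rintro ⟨_ | _⟩ <;> assumption))

theorem biprod_mem_AddClos {W : Set C} {x y : C} (hx : x ∈ AddClos W) (hy : y ∈ AddClos W) :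
    (x ⊞ y) ∈ AddClos W :=
  biprod_mem_of_coproduct_mem (isoClosed_AddClos W) (fun _ => coproduct_mem_AddClos) hx hy

theorem biprod_mem_CoprodN {W : Set C} {l : ℕ} {x y : C} (hx : x ∈ CoprodN W l)
    (hy : y ∈ CoprodN W l) : (x ⊞ y) ∈ CoprodN W l :=
  biprod_mem_of_coproduct_mem (isoClosed_CoprodN W l) (fun _ => coproduct_mem_CoprodN l) hx hy

theorem isZero_mem_CoprodN (W : Set C) (l : ℕ) {x : C} (hx : IsZero x) : x ∈ CoprodN W l := by
  have h : ∐ (PEmpty.elim : PEmpty.{v + 1} → C) ∈ CoprodN W l := coproduct_mem_CoprodN l nofun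
  exact isoClosed_CoprodN W l (IsZero.iso
    ((IsZero.iff_id_eq_zero _).2 (Sigma.hom_ext _ _ nofun)) hx) h

theorem AddClos_subset_CoprodN (W : Set C) {l : ℕ} (hl : 1 ≤ l) :
    AddClos W ⊆ CoprodN W l := by
  obtain ⟨l, rfl⟩ := Nat.exists_eq_add_of_le' hl
  exact fun x hx => ⟨x, 0, 𝟙 x, 0, 0, contractible_distinguished x, hx,
    isZero_mem_CoprodN W l (isZero_zero C)⟩

theorem AddClos_mono {W W' : Set C} (h : W ⊆ W') : AddClos W ⊆ AddClos W' :=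
  fun _ ⟨J, f, hf, e⟩ => ⟨J, f, fun j => h (hf j), e⟩

theorem CoprodN_mono {W W' : Set C} (h : W ⊆ W') : ∀ l, CoprodN W l ⊆ CoprodN W' l
  | 0 => subset_rfl
  | l + 1 => setStar_mono (AddClos_mono h) (CoprodN_mono h l)

theorem shift_mem_AddClos {W W' : Set C} (h : ∀ x ∈ W, x⟦(1 : ℤ)⟧ ∈ W') {x : C}
    (hx : x ∈ AddClos W) : x⟦(1 : ℤ)⟧ ∈ AddClos W' := by
  obtain ⟨J, f, hf, ⟨e⟩⟩ := hx
  exact ⟨J, fun j => (f j)⟦(1 : ℤ)⟧, fun j => h _ (hf j),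
    ⟨(shiftFunctor C (1 : ℤ)).mapIso e ≪≫ PreservesCoproduct.iso (shiftFunctor C (1 : ℤ)) f⟩⟩

theorem shift_mem_CoprodN {W W' : Set C} (h : ∀ x ∈ W, x⟦(1 : ℤ)⟧ ∈ W') (l : ℕ) {x : C}
    (hx : x ∈ CoprodN W l) : x⟦(1 : ℤ)⟧ ∈ CoprodN W' l := by
  induction l generalizing x with
  | zero => exact (shiftFunctor C (1 : ℤ)).map_isZero hx
  | succ l ih =>
    obtain ⟨a, b, f, g, k, hT, ha, hb⟩ := hx
    exact ⟨_, _, _, _, _, Triangle.shift_distinguished _ hT 1, shift_mem_AddClos h ha, ih hb⟩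

/-- Extensions of objects of `CoprodN W' l` by objects of `CoprodN W j`, when `W'` contains `W`
and its shift. -/
theorem mem_CoprodN_add {W W' : Set C} (hW : W ⊆ W') (hW' : ∀ x ∈ W, x⟦(1 : ℤ)⟧ ∈ W')
    {l : ℕ} (hl : 1 ≤ l) (j : ℕ) {b x c : C} {p : b ⟶ x} {q : x ⟶ c} {s : c ⟶ b⟦(1 : ℤ)⟧}
    (h₂ : Triangle.mk p q s ∈ distTriang C) (hb : b ∈ CoprodN W j) (hc : c ∈ CoprodN W' l) :
    x ∈ CoprodN W' (j + l) := by
  induction j generalizing b x c with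
  | zero =>
    have : IsIso q := (Triangle.isZero₁_iff_isIso₂ _ h₂).1 hb
    rw [Nat.zero_add]
    exact isoClosed_CoprodN W' l (asIso q).symm hc
  | succ j ih =>
    obtain ⟨a, a', f, g, h, h₁, ha, ha'⟩ := hb
    obtain ⟨d, d₂, d₃, h₃⟩ := distinguished_cocone_triangle (f ≫ p)
    obtain ⟨e, e₁, e₂, h₄⟩ := distinguished_cocone_triangle₂ (s ≫ g⟦(1 : ℤ)⟧')
    obtain ⟨k, k', y₁, x₁, y₂, x₂, hk, hk'⟩ := exists_equiv_modulo_shift h₁ h₂ h₃ h₄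
    obtain ⟨t⟩ := exists_stable_iso k k' y₁ x₁ y₂ x₂ hk hk'
    have (u v : C) : PreservesBinaryBiproduct u v (shiftFunctor C (1 : ℤ)) :=
      preservesBinaryBiproduct_of_preservesBiproduct _ _ _
    let S (y : C) : C := ∐ fun _ : ULift.{v} ℕ => y ⊞ (y ⊞ y)
    have hS {V : Set C} {y : C} (hy : y ∈ AddClos V) : S y ∈ AddClos V :=
      coproduct_mem_AddClos fun _ => biprod_mem_AddClos hy (biprod_mem_AddClos hy hy)
    have he : (e ⊞ S (a⟦(1 : ℤ)⟧)) ∈ CoprodN W' (j + l) := by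
      have hcS : (c ⊞ S (a⟦(1 : ℤ)⟧)) ∈ CoprodN W' l := biprod_mem_CoprodN hc
        (AddClos_subset_CoprodN W' hl (hS (shift_mem_AddClos hW' ha)))
      obtain ⟨a'', c', _, _, _, hT, ha'', hc'⟩ := biprod_mem_setStar (isoClosed_CoprodN W j)
        (isoClosed_CoprodN W' l) h₄ (contractible_distinguished₁ (S (a⟦(1 : ℤ)⟧)))
        (isoClosed_CoprodN W j (isoBiprodZero (isZero_zero C)) ha') hcS
      exact ih hT ha'' hc'
    have hd : (d ⊞ S (a⟦(1 : ℤ)⟧)) ∈ CoprodN W' (j + l) :=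
      isoClosed_CoprodN W' _ t.symm he
    have hSa : Nonempty ((S a)⟦(1 : ℤ)⟧ ≅ S (a⟦(1 : ℤ)⟧)) :=
      ⟨PreservesCoproduct.iso (shiftFunctor C (1 : ℤ)) _ ≪≫ Limits.Sigma.mapIso fun _ =>
        (shiftFunctor C (1 : ℤ)).mapBiprod _ _ ≪≫
          biprod.mapIso (Iso.refl _) ((shiftFunctor C (1 : ℤ)).mapBiprod _ _)⟩
    obtain ⟨w⟩ := hSa
    have hx : (x ⊞ (0 : C)) ∈ setStar (AddClos W') (CoprodN W' (j + l)) :=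
      biprod_mem_setStar (isoClosed_AddClos W') (isoClosed_CoprodN W' _) h₃
        (rot_of_distTriang _ (contractible_distinguished (S a)))
        (AddClos_mono hW (biprod_mem_AddClos ha (hS ha)))
        (isoClosed_CoprodN W' _ (biprod.mapIso (Iso.refl _) w.symm) hd)
    rw [Nat.add_right_comm]
    exact isoClosed_setStar _ _ (isoBiprodZero (isZero_zero C)).symm hx

theorem smdSet_CoprodN_subset {W W' : Set C} (hW : W ⊆ W') (hW' : ∀ x ∈ W, x⟦(1 : ℤ)⟧ ∈ W')
    {l : ℕ} (hl : 1 ≤ l) : smdSet (CoprodN W l) ⊆ CoprodN W' (2 * l) := by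
  rintro x ⟨b, hb, hx⟩
  obtain ⟨e⟩ := swindle.{v} hx
  have hB : (∐ fun _ : ULift.{v} ℕ => b) ∈ CoprodN W l := coproduct_mem_CoprodN l fun _ => hb
  rw [two_mul]
  exact mem_CoprodN_add hW hW' hl l
    (rot_of_distTriang _ (binaryBiproductTriangle_distinguished (∐ fun _ : ULift.{v} ℕ => b) x))
    (isoClosed_CoprodN W l (e.symm ≪≫ biprod.braiding _ _) hB) (shift_mem_CoprodN hW' l hB)

end Closures

section Window

theorem window_subset (A : Set C) (m : WithBot ℤ) (n : WithTop ℤ) :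
    window A m n ⊆ window A (m + ((-1 : ℤ) : WithBot ℤ)) n := by
  rintro x ⟨a, i, ha, hm, hn, e⟩
  refine ⟨a, i, ha, ?_, hn, e⟩
  induction m using WithBot.recBotCoe with
  | bot => simp
  | coe m =>
    rw [WithBot.coe_le_coe] at hm
    rw [← WithBot.coe_add, WithBot.coe_le_coe]
    lia

theorem shift_mem_window (A : Set C) (m : WithBot ℤ) (n : WithTop ℤ) (x : C)
    (hx : x ∈ window A m n) :
    x⟦(1 : ℤ)⟧ ∈ window A (m + ((-1 : ℤ) : WithBot ℤ)) n := by
  obtain ⟨a, i, ha, hm, hn, ⟨e⟩⟩ := hx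
  refine ⟨a, i + (-1), ha, ?_, le_trans (WithTop.coe_le_coe.2 (by lia)) hn,
    ⟨(shiftFunctor C (1 : ℤ)).mapIso e ≪≫
      ((shiftFunctorAdd' C (-i) 1 (-(i + (-1))) (by lia)).app a).symm⟩⟩
  rw [WithBot.coe_add]
  gcongr

end Window

/-- **Statement 17.** Let `A` be a full subcategory of a triangulated category `T` with
small coproducts, `l ≥ 1`, and `m ≤ n` possibly infinite integers. Then
`Coprod_l(A[m,n]) ⊆ ⟨A⟩̄_l^{[m,n]} ⊆ Coprod_{2l}(A[m−1,n])`, and moreover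
`⟨A⟩̄_l^{[m,n]} = smd(Coprod_l(A[m,n]))`; likewise `⟨A⟩_l^{[m,n]} = smd(coprod_l(A[m,n]))`. -/
theorem gen_coprod (A : Set C) (l : ℕ) (hl : 1 ≤ l)
    (m : WithBot ℤ) (n : WithTop ℤ)
    (hmn : ∃ i : ℤ, m ≤ (i : WithBot ℤ) ∧ (i : WithTop ℤ) ≤ n) :
    (CoprodN (window A m n) l ⊆ GenN A m n l ∧
      GenN A m n l ⊆ CoprodN (window A (m + ((-1 : ℤ) : WithBot ℤ)) n) (2 * l)) ∧
    GenN A m n l = smdSet (CoprodN (window A m n) l) ∧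
    genN A m n l = smdSet (coprodN (window A m n) l) := by
  refine ⟨⟨?_, ?_⟩, GenN_eq_smdSet A m n l, genN_eq_smdSet A m n l⟩
  · rw [GenN_eq_smdSet]
    exact subset_smdSet _
  · rw [GenN_eq_smdSet]
    exact smdSet_CoprodN_subset (window_subset A m n) (shift_mem_window A m n) hl

end Stmt17
end
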